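/- arXiv:2406.10192 — 2 statements merged into one kernel-verified Lean document; each statement's English description precedes it below -/
import Mathlib

section
/- Let G be a connected simple graph of odd order, let v be a vertex of even degree that is not a cut vertex of G, and suppose G − v has no cut vertex. Then G admits an odd 3-edge-covering with overlap at most 2. -/
namespace SimpleGraph

variable {V : Type*}

/-- The degree of a vertex, as a cardinality that needs no decidability instance. -/
noncomputable def ndeg (G : SimpleGraph V) (z : V) : ℕ := (G.neighborSet z).ncard

lemma ndeg_congr {C D : SimpleGraph V} {z : V} (h : ∀ w, C.Adj z w ↔ D.Adj z w) :
    C.ndeg z = D.ndeg z := by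
  unfold ndeg
  congr 1
  ext w
  simp [h w]

lemma ndeg_edge_left {x y : V} (h : x ≠ y) : (edge x y).ndeg x = 1 := by
  rw [ndeg, Set.ncard_eq_one]
  refine ⟨y, ?_⟩
  ext w
  simp [edge_adj]
  grind

lemma ndeg_edge_right {x y : V} (h : x ≠ y) : (edge x y).ndeg y = 1 := by
  rw [edge_comm, ndeg_edge_left h.symm]

variable [Fintype V]

lemma ndeg_eq_degree (G : SimpleGraph V) [DecidableRel G.Adj] (z : V) :
    G.ndeg z = G.degree z := by
  rw [ndeg, Set.ncard_eq_toFinset_card', ← card_neighborFinset_eq_degree]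
  rfl

lemma ndeg_eq_zero_iff {G : SimpleGraph V} {z : V} : G.ndeg z = 0 ↔ ∀ w, ¬ G.Adj z w := by
  rw [ndeg, Set.ncard_eq_zero, Set.eq_empty_iff_forall_notMem]
  rfl

lemma ndeg_sup {C D : SimpleGraph V} (h : Disjoint C D) (z : V) :
    (C ⊔ D).ndeg z = C.ndeg z + D.ndeg z := by
  unfold ndeg
  rw [← Set.ncard_union_eq]
  · congr 1
  · rw [Set.disjoint_left]
    intro w h1 h2
    exact disjoint_left.1 h z w h1 h2

lemma natCast_ndeg_eq_sum (G : SimpleGraph V) [DecidableRel G.Adj] (z : V) :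
    (G.ndeg z : ZMod 2) = ∑ w, if G.Adj z w then 1 else 0 := by
  rw [ndeg_eq_degree, Finset.sum_boole, ← card_neighborFinset_eq_degree, neighborFinset_eq_filter]

lemma natCast_ndeg_symmDiff (C D : SimpleGraph V) (z : V) :
    ((symmDiff C D).ndeg z : ZMod 2) = C.ndeg z + D.ndeg z := by
  classical
  rw [natCast_ndeg_eq_sum, natCast_ndeg_eq_sum, natCast_ndeg_eq_sum, ← Finset.sum_add_distrib]
  refine Finset.sum_congr rfl fun w _ => ?_
  have h2 : (1 : ZMod 2) + 1 = 0 := rfl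
  by_cases h : C.Adj z w <;> by_cases h' : D.Adj z w <;> simp [symmDiff, h, h', h2]

lemma natCast_ndeg_sdiff {C D : SimpleGraph V} (h : D ≤ C) (z : V) :
    ((C \ D).ndeg z : ZMod 2) = C.ndeg z + D.ndeg z := by
  rw [← natCast_ndeg_symmDiff, symmDiff_of_ge h]

lemma sum_natCast_ndeg (G : SimpleGraph V) : ∑ z, (G.ndeg z : ZMod 2) = 0 := by
  classical
  have h := G.sum_degrees_eq_twice_card_edges
  simp only [← ndeg_eq_degree] at h
  rw [← Nat.cast_sum, h]
  push_cast
  rw [show (2 : ZMod 2) = 0 from rfl, zero_mul]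

lemma ndeg_edge_of_ne {x y z : V} (hx : z ≠ x) (hy : z ≠ y) : (edge x y).ndeg z = 0 := by
  rw [ndeg_eq_zero_iff]
  intro w
  simp [edge_adj, hx, hy]

open Classical in
/-- Joining two vertices that are reachable from one another. -/
lemma Reachable.exists_join {K : SimpleGraph V} {x y : V} (h : K.Reachable x y) :
    ∃ J ≤ K, ∀ z, (J.ndeg z : ZMod 2) = (if z = x then 1 else 0) + (if z = y then 1 else 0) := by
  obtain ⟨p⟩ := h
  induction p with
  | nil =>
    refine ⟨⊥, bot_le, fun z => ?_⟩
    rw [ndeg_eq_zero_iff.2 (by simp)]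
    split_ifs <;> rfl
  | @cons a b c hab p ih =>
    obtain ⟨J, hJ, hz⟩ := ih
    refine ⟨symmDiff (edge a b) J, ?_, fun z => ?_⟩
    · exact symmDiff_le_sup.trans (sup_le ((edge_le_iff K).2 (Or.inr hab)) hJ)
    · rw [natCast_ndeg_symmDiff, hz]
      have hne := hab.ne
      by_cases h1 : z = a
      · subst h1
        rw [ndeg_edge_left hne]
        simp [hne]
      · by_cases h2 : z = b
        · subst h2
          rw [ndeg_edge_right hne, if_pos rfl, if_neg h1, ← add_assoc]
          rfl
        · rw [ndeg_edge_of_ne h1 h2]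
          simp [h1, h2]

/-- A set of mutually reachable vertices of even size is the set of odd-degree vertices of some
subgraph. -/
lemma exists_join {K : SimpleGraph V} (T : Finset V) [DecidablePred (· ∈ T)] (hT : Even T.card)
    (hK : ∀ x ∈ T, ∀ y ∈ T, K.Reachable x y) :
    ∃ J ≤ K, ∀ z, (J.ndeg z : ZMod 2) = if z ∈ T then 1 else 0 := by
  classical
  obtain ⟨n, hn⟩ := hT
  induction n generalizing T with
  | zero =>
    have : T = ∅ := by simpa using hn
    subst this
    refine ⟨⊥, bot_le, fun z => ?_⟩
    rw [ndeg_eq_zero_iff.2 (by simp)]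
    simp
  | succ n ih =>
    obtain ⟨x, hx, y, hy, hxy⟩ := Finset.one_lt_card.1 (show 1 < T.card by omega)
    obtain ⟨J, hJ, hz⟩ := ih ((T.erase x).erase y)
      (by intro a ha b hb; exact hK a (by simp_all) b (by simp_all))
      (by rw [Finset.card_erase_of_mem (by simp [hy, hxy.symm]), Finset.card_erase_of_mem hx]; omega)
    obtain ⟨J', hJ', hz'⟩ := (hK x hx y hy).exists_join
    refine ⟨symmDiff J' J, symmDiff_le_sup.trans (sup_le hJ' hJ), fun z => ?_⟩
    rw [natCast_ndeg_symmDiff, hz, hz']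
    by_cases h1 : z = x
    · subst h1
      simp [hx, hxy]
    · by_cases h2 : z = y
      · subst h2
        simp [hy, h1]
      · simp [h1, h2]

/-- A partition of the graph `J`, with `N z` additional half-edges at every vertex `z`, into two
classes in which every vertex has degree zero or odd degree. -/
structure OddSplit (J C D : SimpleGraph V) (N P Q : V → ℕ) : Prop where
  sup_eq : C ⊔ D = J
  disjoint : Disjoint C D
  add_eq : ∀ z, P z + Q z = N z
  left : ∀ z, C.ndeg z + P z = 0 ∨ Odd (C.ndeg z + P z)
  right : ∀ z, D.ndeg z + Q z = 0 ∨ Odd (D.ndeg z + Q z)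

namespace OddSplit

variable {J C D : SimpleGraph V} {N P Q : V → ℕ}

omit [Fintype V] in
lemma symm (h : OddSplit J C D N P Q) : OddSplit J D C N Q P :=
  ⟨by rw [sup_comm, h.sup_eq], h.disjoint.symm, fun z => by rw [add_comm, h.add_eq], h.right, h.left⟩

open Classical in
omit [Fintype V] in
/-- Exchange the two classes on a union of connected components. -/
lemma swap_on (h : OddSplit J C D N P Q) {A : Set V} (hA : ∀ x y, J.Adj x y → (x ∈ A ↔ y ∈ A)) :
    ∃ C' D', OddSplit J C' D' N (fun z => if z ∈ A then Q z else P z)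
      (fun z => if z ∈ A then P z else Q z) := by
  have hC : ∀ x y, C.Adj x y → (x ∈ A ↔ y ∈ A) := fun x y hxy =>
    hA x y (h.sup_eq ▸ Or.inl hxy)
  have hD : ∀ x y, D.Adj x y → (x ∈ A ↔ y ∈ A) := fun x y hxy =>
    hA x y (h.sup_eq ▸ Or.inr hxy)
  have key : ∀ C D : SimpleGraph V, (∀ x y, C.Adj x y → (x ∈ A ↔ y ∈ A)) →
      (∀ x y, D.Adj x y → (x ∈ A ↔ y ∈ A)) →
      ∃ C' : SimpleGraph V, ∀ x y, C'.Adj x y ↔ if x ∈ A then D.Adj x y else C.Adj x y := by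
    intro C D hC hD
    refine ⟨⟨fun x y => if x ∈ A then D.Adj x y else C.Adj x y, ⟨?_⟩, ⟨?_⟩⟩, fun x y => Iff.rfl⟩
    · intro x y hxy
      have h1 := hC x y
      have h2 := hD x y
      have h3 := C.adj_comm x y
      have h4 := D.adj_comm x y
      grind
    · intro x
      simp
  obtain ⟨C', hC'⟩ := key C D hC hD
  obtain ⟨D', hD'⟩ := key D C hD hC
  refine ⟨C', D', ⟨?_, ?_, ?_, ?_, ?_⟩⟩
  · rw [← h.sup_eq]
    ext x y
    simp only [sup_adj, hC', hD']
    split_ifs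
    · exact or_comm
    · rfl
  · rw [disjoint_left]
    intro x y h1 h2
    rw [hC'] at h1
    rw [hD'] at h2
    have := disjoint_left.1 h.disjoint x y
    grind
  · intro z
    have := h.add_eq z
    grind
  · intro z
    by_cases hz : z ∈ A
    · rw [ndeg_congr (C := C') (D := D) (by simp [hC', hz])]
      simpa [hz] using h.right z
    · rw [ndeg_congr (C := C') (D := C) (by simp [hC', hz])]
      simpa [hz] using h.left z
  · intro z
    by_cases hz : z ∈ A
    · rw [ndeg_congr (C := D') (D := C) (by simp [hD', hz])]
      simpa [hz] using h.left z
    · rw [ndeg_congr (C := D') (D := D) (by simp [hD', hz])]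
      simpa [hz] using h.right z

open Classical in
/-- Join two half-edges in the same class to an edge. -/
lemma sup_edge {y z : V} (hyz : ¬ J.Adj y z) (hne : y ≠ z)
    (h : OddSplit J C D (fun w => N w + ((if w = y then 1 else 0) + if w = z then 1 else 0)) P Q)
    (hy : P y ≠ 0) (hz : P z ≠ 0) :
    OddSplit (J ⊔ edge y z) (C ⊔ edge y z) D N
      (fun w => P w - ((if w = y then 1 else 0) + if w = z then 1 else 0)) Q := by
  have hC : Disjoint C (edge y z) :=
    (disjoint_edge C).2 fun hc => hyz (h.sup_eq ▸ Or.inl hc)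
  have hD : Disjoint D (edge y z) :=
    (disjoint_edge D).2 fun hc => hyz (h.sup_eq ▸ Or.inr hc)
  refine ⟨?_, ?_, ?_, ?_, h.right⟩
  · rw [sup_right_comm, h.sup_eq]
  · exact disjoint_sup_left.2 ⟨h.disjoint, hD.symm⟩
  · intro w
    have := h.add_eq w
    grind
  · intro w
    have := h.left w
    rw [ndeg_sup hC]
    by_cases h1 : w = y
    · subst h1
      simpa [hne, ndeg_edge_left hne, show C.ndeg w + 1 + (P w - 1) = C.ndeg w + P w by omega]
    · by_cases h2 : w = z
      · subst h2
        simpa [h1, ndeg_edge_right hne, show C.ndeg w + 1 + (P w - 1) = C.ndeg w + P w by omega]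
      · simpa [h1, h2, ndeg_edge_of_ne h1 h2]

end OddSplit

/-- A forest with half-edges splits into two odd classes. -/
lemma IsAcyclic.exists_oddSplit {J : SimpleGraph V} (hJ : J.IsAcyclic) (N : V → ℕ) :
    ∃ C D P Q, OddSplit J C D N P Q := by
  classical
  induction J using WellFoundedLT.induction generalizing N with
  | ind J ih =>
  by_cases hb : J = ⊥
  · subst hb
    refine ⟨⊥, ⊥, fun z => if Even (N z) then N z - 1 else N z,
      fun z => if Even (N z) then N z - (N z - 1) else 0, ⟨by simp, by simp, ?_, ?_, ?_⟩⟩ <;>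
      intro z
    · grind
    · rw [ndeg_eq_zero_iff.2 (by simp)]
      grind
    · rw [ndeg_eq_zero_iff.2 (by simp)]
      grind
  · obtain ⟨y, z, hyz⟩ := ne_bot_iff_exists_adj.1 hb
    have hne := hyz.ne
    set J' := J \ edge y z with hJ'
    have hnadj : ¬ J'.Adj y z := by simp [hJ', edge_adj, hne]
    have hsup : J' ⊔ edge y z = J :=
      sdiff_sup_cancel ((edge_le_iff J).2 (Or.inr hyz))
    have hlt : J' < J := by
      refine lt_of_le_of_ne sdiff_le fun h => hnadj (h ▸ hyz)
    have hreach : ¬ J'.Reachable y z := by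
      have h0 := isAcyclic_iff_forall_adj_isBridge.1 hJ hyz
      simpa [isBridge_iff, deleteEdges, hJ', edge] using h0
    obtain ⟨C, D, P, Q, h⟩ := ih J' hlt (hJ.anti hlt.le)
      (fun w => N w + ((if w = y then 1 else 0) + if w = z then 1 else 0))
    have hy := h.add_eq y
    have hz := h.add_eq z
    simp only [if_true] at hy hz
    have finish : ∀ C D P Q, OddSplit J' C D
        (fun w => N w + ((if w = y then 1 else 0) + if w = z then 1 else 0)) P Q →
        P y ≠ 0 → P z ≠ 0 → ∃ C D P Q, OddSplit J C D N P Q := by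
      intro C D P Q h h1 h2
      have := h.sup_edge hnadj hne h1 h2
      rw [hsup] at this
      exact ⟨_, _, _, _, this⟩
    obtain ⟨C', D', h'⟩ := h.swap_on (A := {w | J'.Reachable y w})
      (fun a b hab => ⟨fun h => h.trans hab.reachable, fun h => h.trans hab.symm.reachable⟩)
    by_cases h1 : P y = 0 <;> by_cases h2 : P z = 0
    · exact finish _ _ _ _ h.symm (by omega) (by omega)
    · exact finish _ _ _ _ h' (by simp; omega) (by simpa [hreach] using h2)
    · exact finish _ _ _ _ h'.symm (by simpa using h1) (by simp [hreach]; omega)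
    · exact finish _ _ _ _ h h1 h2

end SimpleGraph
/-- Connectedness of a set for a relation: no splitting of the set into two nonempty parts
without a related pair across. -/
def CutConn {U : Type*} (r : U → U → Prop) (A : Set U) : Prop :=
  ∀ X : Set U, (∃ a ∈ A, a ∈ X) → (∃ b ∈ A, b ∉ X) → ∃ a ∈ A, ∃ b ∈ A, a ∈ X ∧ b ∉ X ∧ r a b

namespace CutConn

variable {U W : Type*} {r : U → U → Prop}

lemma singleton (x : U) : CutConn r {x} := by
  rintro X ⟨a, rfl, ha⟩ ⟨b, rfl, hb⟩
  exact absurd ha hb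

lemma of_preimage {π : U → W} (hπ : Function.Surjective π) {A : Set W}
    (h : CutConn r (π ⁻¹' A)) :
    CutConn (fun w w' => ∃ x y, π x = w ∧ π y = w' ∧ r x y) A := by
  rintro X ⟨a, ha, haX⟩ ⟨b, hb, hbX⟩
  obtain ⟨a, rfl⟩ := hπ a
  obtain ⟨b, rfl⟩ := hπ b
  obtain ⟨x, hx, y, hy, hxX, hyX, hxy⟩ := h (π ⁻¹' X) ⟨a, ha, haX⟩ ⟨b, hb, hbX⟩
  exact ⟨π x, hx, π y, hy, hxX, hyX, x, y, rfl, rfl, hxy⟩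

lemma preimage {π : U → W} (hfib : ∀ w, CutConn r (π ⁻¹' {w})) {A : Set W}
    (h : CutConn (fun w w' => ∃ x y, π x = w ∧ π y = w' ∧ r x y) A) :
    CutConn r (π ⁻¹' A) := by
  rintro X ⟨a, ha, haX⟩ ⟨b, hb, hbX⟩
  by_cases hs : ∃ x y, π x ∈ A ∧ π x = π y ∧ x ∈ X ∧ y ∉ X
  · obtain ⟨x, y, hxA, hxy, hxX, hyX⟩ := hs
    obtain ⟨p, hp, q, hq, h1, h2, h3⟩ := hfib (π x) X ⟨x, rfl, hxX⟩ ⟨y, hxy.symm, hyX⟩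
    refine ⟨p, ?_, q, ?_, h1, h2, h3⟩
    · rw [Set.mem_preimage, show π p = π x from hp]; exact hxA
    · rw [Set.mem_preimage, show π q = π x from hq]; exact hxA
  · push Not at hs
    obtain ⟨_, hp, _, hq, ⟨x, hxX, hx⟩, h2, p, q, rfl, rfl, hpq⟩ :=
      h (π '' X) ⟨π a, ha, a, haX, rfl⟩ ⟨π b, hb, by
        rintro ⟨x, hx, hxb⟩
        exact hbX (hs x b (by rw [hxb]; exact hb) hxb hx)⟩
    refine ⟨p, hp, q, hq, hs x p (hx ▸ hp) hx hxX, fun hqX => h2 ⟨q, hqX, rfl⟩, hpq⟩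

/-- If no single vertex separates, then two vertices can be separated by a cut both of whose sides
are connected and have at least two elements. -/
lemma exists_separating [Fintype U] (hr : ∀ x y, r x y → r y x) (hcut : ∀ w, CutConn r {w}ᶜ) {s t : U}
    (hst : s ≠ t) (hcard : 4 ≤ Fintype.card U) :
    ∃ A : Set U, s ∈ A ∧ t ∉ A ∧ CutConn r A ∧ CutConn r Aᶜ ∧ (∃ x ∈ A, x ≠ s) ∧ ∃ x ∉ A, x ≠ t := by
  classical
  have hex : ∀ F : Finset U, F.card ≤ 3 → ∃ x, x ∉ F := by
    intro F hF
    by_contra! hc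
    have : F = Finset.univ := Finset.eq_univ_iff_forall.2 hc
    rw [this, Finset.card_univ] at hF
    omega
  obtain ⟨c, hc⟩ := hex {s, t} (Finset.card_le_two.trans (by norm_num))
  obtain ⟨a, -, b, hb, has, hbs, hsb⟩ := hcut t {s} ⟨s, hst, rfl⟩ ⟨c, by grind, by grind⟩
  rw [show a = s from has] at hsb
  have hbt : b ≠ t := hb
  have hbs : b ≠ s := hbs
  by_cases hAb : CutConn r ({s, b}ᶜ : Set U)
  · refine ⟨{s, b}, by simp, by grind, ?_, hAb, ⟨b, by simp, hbs⟩, ?_⟩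
    · rintro X ⟨x, hx, hxX⟩ ⟨y, hy, hyX⟩
      have := hr _ _ hsb
      rcases hx with rfl | rfl <;> rcases hy with rfl | rfl <;> first | contradiction | skip
      · exact ⟨x, by simp, y, by simp, hxX, hyX, hsb⟩
      · exact ⟨x, by simp, y, by simp, hxX, hyX, this⟩
    · obtain ⟨d, hd⟩ := hex {s, b, t} Finset.card_le_three
      exact ⟨d, by grind, by grind⟩
  · have main : ∀ X : Set U, t ∉ X → (∃ x, x ≠ s ∧ x ≠ b ∧ x ∈ X) →
        (∀ x y, x ≠ s → x ≠ b → x ∈ X → y ≠ s → y ≠ b → y ∉ X → ¬ r x y) →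
        ∃ A : Set U, s ∈ A ∧ t ∉ A ∧ CutConn r A ∧ CutConn r Aᶜ ∧ (∃ x ∈ A, x ≠ s) ∧
          ∃ x ∉ A, x ≠ t := by
      intro X htX hX hsep
      refine ⟨{x | x = s ∨ (x ≠ b ∧ x ∈ X)}, by simp, by grind, ?_, ?_,
        hX.imp fun x hx => ⟨Or.inr hx.2, hx.1⟩, ⟨b, by grind, by grind⟩⟩
      · rintro Y ⟨x, hx, hxY⟩ ⟨y, hy, hyY⟩
        by_cases hsY : s ∈ Y
        · obtain ⟨p, hp, q, hq, h1, h2, h3⟩ :=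
            hcut b {z | ¬ ((z = s ∨ z ≠ b ∧ z ∈ X) ∧ z ∉ Y)} ⟨s, hbs.symm, by simp [hsY]⟩
              ⟨y, by simp only [Set.mem_compl_iff, Set.mem_singleton_iff]; grind, by
                simp only [Set.mem_ofPred_eq, not_not]; exact ⟨hy, hyY⟩⟩
          have := hsep q p
          have := hr _ _ h3
          simp only [Set.mem_compl_iff, Set.mem_singleton_iff, Set.mem_ofPred_eq, not_not] at *
          refine ⟨p, ?_, q, ?_, ?_, ?_, h3⟩ <;> grind
        · obtain ⟨p, hp, q, hq, h1, h2, h3⟩ :=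
            hcut b {z | ((z = s ∨ z ≠ b ∧ z ∈ X) ∧ z ∈ Y)}
              ⟨x, by simp only [Set.mem_compl_iff, Set.mem_singleton_iff]; grind, hx, hxY⟩
              ⟨s, hbs.symm, by simp [hsY]⟩
          have := hsep p q
          simp only [Set.mem_compl_iff, Set.mem_singleton_iff, Set.mem_ofPred_eq] at *
          refine ⟨p, ?_, q, ?_, ?_, ?_, h3⟩ <;> grind
      · rintro Y ⟨x, hx, hxY⟩ ⟨y, hy, hyY⟩
        by_cases hsY : b ∈ Y
        · obtain ⟨p, hp, q, hq, h1, h2, h3⟩ :=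
            hcut s {z | ¬ (¬ (z = s ∨ z ≠ b ∧ z ∈ X) ∧ z ∉ Y)} ⟨b, hbs, by simp [hsY]⟩
              ⟨y, by
                simp only [Set.mem_compl_iff, Set.mem_singleton_iff, Set.mem_ofPred_eq] at *
                grind, by
                simp only [Set.mem_ofPred_eq, not_not]; exact ⟨hy, hyY⟩⟩
          have := hsep p q
          simp only [Set.mem_compl_iff, Set.mem_singleton_iff, Set.mem_ofPred_eq, not_not] at *
          refine ⟨p, ?_, q, ?_, ?_, ?_, h3⟩ <;> grind
        · obtain ⟨p, hp, q, hq, h1, h2, h3⟩ :=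
            hcut s {z | (¬ (z = s ∨ z ≠ b ∧ z ∈ X) ∧ z ∈ Y)}
              ⟨x, by
                simp only [Set.mem_compl_iff, Set.mem_singleton_iff, Set.mem_ofPred_eq] at *
                grind, hx, hxY⟩
              ⟨b, hbs, by simp [hsY]⟩
          have := hsep q p
          have := hr _ _ h3
          simp only [Set.mem_compl_iff, Set.mem_singleton_iff, Set.mem_ofPred_eq] at *
          refine ⟨p, ?_, q, ?_, ?_, ?_, h3⟩ <;> grind
    unfold CutConn at hAb
    push Not at hAb
    obtain ⟨X, ⟨x, hx, hxX⟩, ⟨y, hy, hyX⟩, h⟩ := hAb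
    simp only [Set.mem_compl_iff, Set.mem_insert_iff, Set.mem_singleton_iff, not_or] at hx hy h
    by_cases htX : t ∈ X
    · refine main Xᶜ (by simpa using htX) ⟨y, hy.1, hy.2, hyX⟩ ?_
      intro p q h1 h2 h3 h4 h5 h6 h7
      exact h q ⟨h4, h5⟩ p ⟨h1, h2⟩ (by simpa using h6) h3 (hr _ _ h7)
    · refine main X htX ⟨x, hx.1, hx.2, hxX⟩ ?_
      intro p q h1 h2 h3 h4 h5 h6 h7
      exact h p ⟨h1, h2⟩ q ⟨h4, h5⟩ h3 h6 h7

end CutConn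

/-- If no single vertex separates, and two labellings in `ZMod 2` are nonzero with zero total, then
some cut with both sides connected has odd labels for both of them. -/
lemma exists_odd_cut (k : ℕ) {U : Type*} [Fintype U] {r : U → U → Prop}
    (hk : Fintype.card U ≤ k) (hr : ∀ x y, r x y → r y x) (hcut : ∀ w, CutConn r {w}ᶜ)
    (e n : U → ZMod 2) (he : ∑ x, e x = 0) (hn : ∑ x, n x = 0) (hs : ∃ s, e s ≠ 0)
    (hp : ∃ p, n p ≠ 0) :
    ∃ A : Finset U, CutConn r A ∧ CutConn r (A : Set U)ᶜ ∧
      ∑ x ∈ A, e x = 1 ∧ ∑ x ∈ A, n x = 1 := by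
  classical
  have hbit : ∀ a : ZMod 2, a ≠ 0 → a = 1 := by decide
  induction k generalizing U with
  | zero =>
    obtain ⟨s, -⟩ := hs
    have := Fintype.card_pos_iff.2 ⟨s⟩
    omega
  | succ k ih =>
  by_cases hboth : ∃ x, e x ≠ 0 ∧ n x ≠ 0
  · obtain ⟨x, h1, h2⟩ := hboth
    refine ⟨{x}, ?_, ?_, ?_, ?_⟩
    · rw [Finset.coe_singleton]
      exact CutConn.singleton x
    · rw [Finset.coe_singleton]
      exact hcut x
    · rw [Finset.sum_singleton, hbit _ h1]
    · rw [Finset.sum_singleton, hbit _ h2]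
  push Not at hboth
  have contract : ∀ (A : Set U) (s : U), s ∈ A → (∃ x ∈ A, x ≠ s) → CutConn r A → CutConn r Aᶜ →
      (∃ t, t ∉ A ∧ e t ≠ 0) → (∃ p, p ∉ A ∧ n p ≠ 0) →
      ∃ A : Finset U, CutConn r A ∧ CutConn r (A : Set U)ᶜ ∧
        ∑ x ∈ A, e x = 1 ∧ ∑ x ∈ A, n x = 1 := by
    rintro A s hsA ⟨x, hxA, hxs⟩ hA hA' ⟨t, htA, ht⟩ ⟨p, hpA, hp⟩
    let W := {x // x ∉ A ∨ x = s}
    let π : U → W := fun x => if h : x ∈ A then ⟨s, Or.inr rfl⟩ else ⟨x, Or.inl h⟩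
    have hπA : ∀ x, x ∈ A → (π x).1 = s := fun x hx => by simp [π, hx]
    have hπB : ∀ x, x ∉ A → (π x).1 = x := fun x hx => by simp [π, hx]
    have hcard : Fintype.card W ≤ k := by
      have : Fintype.card W < Fintype.card U :=
        Fintype.card_subtype_lt (p := fun x => x ∉ A ∨ x = s) (x := x) (by simp [hxA, hxs])
      omega
    have hsurj : Function.Surjective π := by
      rintro ⟨y, hy⟩
      refine ⟨y, Subtype.ext ?_⟩
      rcases hy with hy | rfl
      · exact hπB y hy
      · exact hπA y hsA
    have hfib : ∀ w : W, π ⁻¹' {w} = A ∨ π ⁻¹' {w} = {w.1} := by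
      rintro ⟨y, hy⟩
      by_cases hyA : y ∈ A
      · left
        ext z
        rw [Set.mem_preimage, Set.mem_singleton_iff, Subtype.ext_iff]
        by_cases hz : z ∈ A
        · simp only [hπA z hz, hz, iff_true]
          grind
        · simp only [hπB z hz, hz, iff_false]
          grind
      · right
        ext z
        rw [Set.mem_preimage, Set.mem_singleton_iff, Subtype.ext_iff, Set.mem_singleton_iff]
        by_cases hz : z ∈ A
        · simp only [hπA z hz]
          grind
        · simp only [hπB z hz]
    have hfib₁ : ∀ w : W, CutConn r (π ⁻¹' {w}) := by
      intro w
      rcases hfib w with h | h <;> rw [h]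
      · exact hA
      · exact CutConn.singleton _
    have hfib₂ : ∀ w : W, CutConn r (π ⁻¹' {w}ᶜ) := by
      intro w
      rw [Set.preimage_compl]
      rcases hfib w with h | h <;> rw [h]
      · exact hA'
      · exact hcut _
    have hlab : ∀ f : U → ZMod 2, ∀ t, t ∉ A → ∑ x with π x = π t, f x = f t := by
      intro f t ht
      refine Finset.sum_eq_single_of_mem t (by simp) ?_
      intro y hy hyt
      rw [Finset.mem_filter, Subtype.ext_iff, hπB t ht] at hy
      by_cases hyA : y ∈ A
      · rw [hπA y hyA] at hy
        exact absurd (hy.2 ▸ hsA) ht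
      · rw [hπB y hyA] at hy
        exact absurd hy.2 hyt
    obtain ⟨B, h1, h2, h3, h4⟩ := ih (r := fun w w' => ∃ x y, π x = w ∧ π y = w' ∧ r x y) hcard
      (fun w w' ⟨x, y, hx, hy, hxy⟩ => ⟨y, x, hy, hx, hr _ _ hxy⟩)
      (fun w => CutConn.of_preimage hsurj (hfib₂ w))
      (fun w => ∑ x with π x = w, e x) (fun w => ∑ x with π x = w, n x)
      (by rw [Finset.sum_fiberwise, he]) (by rw [Finset.sum_fiberwise, hn])
      ⟨π t, by rw [hlab e t htA]; exact ht⟩ ⟨π p, by rw [hlab n p hpA]; exact hp⟩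
    have hB : ((Finset.univ.filter fun x => π x ∈ B : Finset U) : Set U) = π ⁻¹' (B : Set W) := by
      ext
      simp
    refine ⟨Finset.univ.filter fun x => π x ∈ B, ?_, ?_, ?_, ?_⟩
    · rw [hB]
      exact h1.preimage hfib₁
    · rw [hB, ← Set.preimage_compl]
      exact h2.preimage hfib₁
    · rw [← h3, Finset.sum_fiberwise_eq_sum_filter]
    · rw [← h4, Finset.sum_fiberwise_eq_sum_filter]
  have hpair : ∀ f : U → ZMod 2, ∑ x, f x = 0 → ∀ s, f s ≠ 0 → ∃ t, t ≠ s ∧ f t ≠ 0 := by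
    intro f hf s hs
    by_contra! hc
    exact hs (by rw [← hf, Finset.sum_eq_single s (fun b _ hb => hc b hb) (by simp)])
  obtain ⟨s, hs⟩ := hs
  obtain ⟨p, hp⟩ := hp
  obtain ⟨t, hts, ht⟩ := hpair e he s hs
  obtain ⟨q, hqp, hq⟩ := hpair n hn p hp
  have hcard : 4 ≤ Fintype.card U := by
    have : ({s, t, p, q} : Finset U).card = 4 := by
      have h1 := hboth s hs
      have h2 := hboth t ht
      rw [Finset.card_insert_of_notMem, Finset.card_insert_of_notMem,
        Finset.card_insert_of_notMem, Finset.card_singleton] <;>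
        simp only [Finset.mem_insert, Finset.mem_singleton] <;> grind
    exact this ▸ Finset.card_le_univ _
  obtain ⟨A, hsA, htA, hA, hA', hsx, y, hyA, hyt⟩ :=
    CutConn.exists_separating hr hcut hts.symm hcard
  by_cases hnA : ∃ p, p ∉ A ∧ n p ≠ 0
  · exact contract A s hsA hsx hA hA' ⟨t, htA, ht⟩ hnA
  · push Not at hnA
    have hpA : p ∈ A := by
      by_contra h
      exact hp (hnA p h)
    exact contract Aᶜ t htA ⟨y, hyA, hyt⟩ hA' (by rwa [compl_compl]) ⟨s, by simpa using hsA, hs⟩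
      ⟨p, by simpa using hpA, hp⟩

namespace SimpleGraph

variable {V : Type*} [Fintype V]

/-- The star with centre `v` whose leaves are the vertices with a half-edge in `P`. -/
def spokes (v : V) (P : V → ℕ) : SimpleGraph V := fromRel fun x y => x = v ∧ P y ≠ 0

omit [Fintype V] in
lemma spokes_adj {v : V} {P : V → ℕ} (hv : P v = 0) {x y : V} :
    (spokes v P).Adj x y ↔ (x = v ∧ P y ≠ 0) ∨ (y = v ∧ P x ≠ 0) := by
  simp only [spokes, fromRel_adj]
  grind

lemma ndeg_spokes_centre {v : V} {P : V → ℕ} (hv : P v = 0) (hP : ∀ z, P z ≤ 1) :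
    (spokes v P).ndeg v = ∑ z, P z := by
  classical
  have h : (spokes v P).neighborSet v = ↑(Finset.univ.filter fun z => P z ≠ 0) := by
    ext z
    simp [mem_neighborSet, spokes_adj hv, hv]
  rw [ndeg, h, Set.ncard_coe_finset, Finset.card_filter]
  refine Finset.sum_congr rfl fun z _ => ?_
  have := hP z
  split_ifs <;> omega

omit [Fintype V] in
lemma ndeg_spokes_of_ne {v : V} {P : V → ℕ} (hv : P v = 0) {z : V} (hz : z ≠ v) (hP : P z ≤ 1) :
    (spokes v P).ndeg z = P z := by
  by_cases h : P z = 0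
  · rw [h, ndeg, show (spokes v P).neighborSet z = ∅ by
      ext w; simp [mem_neighborSet, spokes_adj hv, hz, h], Set.ncard_empty]
  · rw [show P z = 1 by omega, ndeg, show (spokes v P).neighborSet z = {v} by
      ext w; simp [mem_neighborSet, spokes_adj hv, hz, h], Set.ncard_singleton]

/-- A graph is the union of three graphs all of whose nonzero degrees are odd, in such a way that
at most one edge lies in more than one of them, and no edge lies in all three. -/
def HasOddCover (G : SimpleGraph V) : Prop :=
  ∃ (C : Fin 3 → SimpleGraph V) (f : Sym2 V), (∀ x y, G.Adj x y ↔ ∃ j, (C j).Adj x y) ∧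
    (∀ j z, (C j).ndeg z = 0 ∨ Odd ((C j).ndeg z)) ∧
    (∀ i j x y, i ≠ j → (C i).Adj x y → (C j).Adj x y → s(x, y) = f) ∧ ∃ j, f ∉ (C j).edgeSet

lemma HasOddCover.exists_covering {G : SimpleGraph V} [DecidableEq V] [DecidableRel G.Adj]
    (h : G.HasOddCover) : ∃ ψ : Sym2 V → Finset (Fin 3),
      (∀ e ∈ G.edgeSet, (ψ e).Nonempty) ∧
      (∀ (j : Fin 3) (u : V),
        {e | e ∈ G.edgeSet ∧ j ∈ ψ e ∧ u ∈ e}.ncard = 0 ∨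
          Odd {e | e ∈ G.edgeSet ∧ j ∈ ψ e ∧ u ∈ e}.ncard) ∧
      (∑ e ∈ G.edgeFinset, (if 2 ≤ (ψ e).card then (ψ e).card else 0)) ≤ 2 := by
  classical
  obtain ⟨C, f, hadj, hodd, hf, j₀, hj₀⟩ := h
  refine ⟨fun e => Finset.univ.filter fun j => e ∈ (C j).edgeSet, ?_, ?_, ?_⟩
  · intro e
    induction e with
    | h x y =>
      intro he
      obtain ⟨j, hj⟩ := (hadj x y).1 he
      exact ⟨j, by simpa using hj⟩
  · intro j u
    have hset : {e | e ∈ G.edgeSet ∧ (j ∈ Finset.univ.filter fun j => e ∈ (C j).edgeSet) ∧ u ∈ e} =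
        (fun w => s(u, w)) '' (C j).neighborSet u := by
      ext e
      induction e with
      | h x y =>
        have h1 := hadj x y
        have h2 := (C j).adj_comm x y
        simp only [Set.mem_ofPred_eq, mem_edgeSet, Finset.mem_filter, Finset.mem_univ, true_and,
          Set.mem_image, mem_neighborSet, Sym2.mem_iff, Sym2.eq_iff]
        constructor
        · rintro ⟨-, h3, rfl | rfl⟩
          · exact ⟨y, h3, Or.inl ⟨rfl, rfl⟩⟩
          · exact ⟨x, h2.1 h3, Or.inr ⟨rfl, rfl⟩⟩
        · rintro ⟨w, h3, ⟨rfl, rfl⟩ | ⟨rfl, rfl⟩⟩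
          · exact ⟨h1.2 ⟨j, h3⟩, h3, Or.inl rfl⟩
          · exact ⟨h1.2 ⟨j, h2.2 h3⟩, h2.2 h3, Or.inr rfl⟩
    rw [hset, Set.ncard_image_of_injective _ (fun a b hab => Sym2.congr_right.1 hab)]
    exact hodd j u
  · have hle : ∀ e, (if 2 ≤ (Finset.univ.filter fun j => e ∈ (C j).edgeSet).card then
        (Finset.univ.filter fun j => e ∈ (C j).edgeSet).card else 0) ≤ if e = f then 2 else 0 := by
      intro e
      by_cases he : e = f
      · subst he
        have : (Finset.univ.filter fun j => e ∈ (C j).edgeSet).card < (Finset.univ : Finset (Fin 3)).card :=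
          Finset.card_lt_card (Finset.filter_ssubset.2 ⟨j₀, Finset.mem_univ _, hj₀⟩)
        rw [Finset.card_univ, Fintype.card_fin] at this
        simp only [if_true]
        split_ifs <;> omega
      · rw [if_neg he, if_neg]
        intro h2
        obtain ⟨i, hi, j, hj, hij⟩ := Finset.one_lt_card.1 h2
        simp only [Finset.mem_filter, Finset.mem_univ, true_and] at hi hj
        induction e with
        | h x y => exact he (hf i j x y hij hi hj)
    refine (Finset.sum_le_sum fun e _ => hle e).trans ?_
    rw [Finset.sum_ite_eq']
    split_ifs <;> omega

open Classical in
/-- An odd graph `F` and an odd splitting of `J` with half-edges at the neighbours of `v` give an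
odd cover. -/
lemma OddSplit.hasOddCover {G F J C D : SimpleGraph V} {P Q : V → ℕ} {v : V} {f : Sym2 V}
    (h : OddSplit J C D (fun z => if G.Adj v z then 1 else 0) P Q)
    (hadj : ∀ x y, x ≠ v → y ≠ v → (G.Adj x y ↔ F.Adj x y ∨ J.Adj x y))
    (hFv : ∀ z, ¬ F.Adj v z) (hJv : ∀ z, ¬ J.Adj v z)
    (hf : ∀ x y, F.Adj x y → J.Adj x y → s(x, y) = f)
    (hF : ∀ z, z ≠ v → Odd (F.ndeg z)) (hP : Odd (∑ z, P z)) (hQ : Odd (∑ z, Q z)) :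
    G.HasOddCover := by
  have hPv : P v = 0 := by
    have := h.add_eq v
    simp at this
    omega
  have hQv : Q v = 0 := by
    have := h.add_eq v
    simp at this
    omega
  have hle : ∀ z, P z + Q z ≤ 1 := by
    intro z
    have := h.add_eq z
    split_ifs at this <;> omega
  have hJadj : ∀ x y, J.Adj x y ↔ C.Adj x y ∨ D.Adj x y := by
    intro x y
    rw [← h.sup_eq, sup_adj]
  have hdisj := fun x y => disjoint_left.1 h.disjoint x y
  have hspokes : ∀ x y, ((spokes v P).Adj x y ∨ (spokes v Q).Adj x y) ↔
      G.Adj x y ∧ (x = v ∨ y = v) := by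
    intro x y
    have hx := h.add_eq x
    have hy := h.add_eq y
    have := G.adj_comm x y
    rw [spokes_adj hPv, spokes_adj hQv]
    by_cases h1 : x = v
    · subst h1
      have : ¬ G.Adj x x := G.irrefl
      grind
    · by_cases h2 : y = v
      · subst h2
        grind
      · simp [h1, h2]
  have key : ∀ (C : SimpleGraph V) (P : V → ℕ), P v = 0 → (∀ z, P z ≤ 1) →
      (∀ z, ¬ C.Adj v z) → (∀ z, C.ndeg z + P z = 0 ∨ Odd (C.ndeg z + P z)) → Odd (∑ z, P z) →
      ∀ z, (C ⊔ spokes v P).ndeg z = 0 ∨ Odd ((C ⊔ spokes v P).ndeg z) := by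
    intro C P hPv hP hC hCP hodd z
    have hd : Disjoint C (spokes v P) := by
      rw [disjoint_left]
      intro x y hxy
      rw [spokes_adj hPv]
      have := hxy.symm
      grind
    rw [ndeg_sup hd]
    by_cases hz : z = v
    · subst hz
      right
      rw [ndeg_eq_zero_iff.2 hC, zero_add, ndeg_spokes_centre hPv hP]
      exact hodd
    · rw [ndeg_spokes_of_ne hPv hz (hP z)]
      exact hCP z
  have hdis : ∀ x y, (C ⊔ spokes v P).Adj x y → ¬ (D ⊔ spokes v Q).Adj x y := by
    intro x y
    rw [sup_adj, sup_adj, spokes_adj hPv, spokes_adj hQv]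
    have h1 := hJadj x y
    have h2 := hdisj x y
    have h3 := hJv x
    have h4 := hJv y
    have h5 := J.adj_comm x y
    have h6 := hle x
    have h7 := hle y
    grind
  have hFJ : ∀ x y, F.Adj x y → ((C ⊔ spokes v P).Adj x y ∨ (D ⊔ spokes v Q).Adj x y) →
      J.Adj x y := by
    intro x y
    rw [sup_adj, sup_adj, hJadj]
    have h1 := hspokes x y
    have h3 := hFv x
    have h4 := hFv y
    have h5 := F.adj_comm x y
    grind
  refine ⟨![F, C ⊔ spokes v P, D ⊔ spokes v Q], f, ?_, ?_, ?_, ?_⟩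
  · intro x y
    have h1 := hspokes x y
    have h2 := hadj x y
    have h3 := hJadj x y
    have h4 := hFv y
    have h5 := hJv y
    have h6 : ¬ F.Adj x v := fun h => hFv x h.symm
    have h7 : ¬ J.Adj x v := fun h => hJv x h.symm
    simp only [Fin.exists_fin_succ, Matrix.cons_val_zero, Matrix.cons_val_succ, sup_adj,
      IsEmpty.exists_iff, or_false]
    by_cases hx : x = v
    · subst hx
      tauto
    · by_cases hy : y = v
      · subst hy
        tauto
      · tauto
  · intro j
    fin_cases j
    · intro z
      by_cases hz : z = v
      · subst hz
        exact Or.inl (ndeg_eq_zero_iff.2 hFv)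
      · exact Or.inr (hF z hz)
    · exact key C P hPv (fun z => by have := hle z; omega) (fun z hz => hJv z ((hJadj _ _).2 (Or.inl hz)))
        h.left hP
    · exact key D Q hQv (fun z => by have := hle z; omega) (fun z hz => hJv z ((hJadj _ _).2 (Or.inr hz)))
        h.right hQ
  · intro i j x y hij
    have h1 := hdis x y
    have h2 := hFJ x y
    have h3 := hf x y
    fin_cases i <;> fin_cases j <;> simp at hij ⊢ <;> grind
  · induction f with
    | h x y =>
      by_contra! hc
      exact hdis x y (hc 1) (hc 2)

end SimpleGraph

namespace SimpleGraph

variable {V : Type*}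

lemma Reachable.exists_adj_crossing {K : SimpleGraph V} {a b : V} (h : K.Reachable a b) {X : Set V}
    (ha : a ∈ X) (hb : b ∉ X) : ∃ x ∈ X, ∃ y, y ∉ X ∧ K.Adj x y := by
  obtain ⟨p⟩ := h
  obtain ⟨d, -, h1, h2⟩ := p.exists_boundary_dart X ha hb
  exact ⟨_, h1, _, h2, d.adj⟩

lemma reachable_of_cutConn {U : Type*} {r : U → U → Prop} {A : Set U} (h : CutConn r A)
    {K : SimpleGraph V} (f : U → V) (hK : ∀ a ∈ A, ∀ b ∈ A, r a b → K.Adj (f a) (f b))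
    {a b : U} (ha : a ∈ A) (hb : b ∈ A) : K.Reachable (f a) (f b) := by
  by_contra hab
  obtain ⟨x, hx, y, hy, h1, h2, h3⟩ := h {z | K.Reachable (f a) (f z)} ⟨a, ha, Reachable.refl _⟩
    ⟨b, hb, hab⟩
  exact h2 (Reachable.trans h1 (hK x hx y hy h3).reachable)

variable [Fintype V]

open Classical in
lemma exists_join_of_sum_eq_zero {K : SimpleGraph V} (S : Finset V) (t : V → ZMod 2)
    (ht : ∑ z ∈ S, t z = 0) (hK : ∀ x ∈ S, ∀ y ∈ S, K.Reachable x y) :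
    ∃ J ≤ K, ∀ z, (J.ndeg z : ZMod 2) = if z ∈ S then t z else 0 := by
  have hbit : ∀ a : ZMod 2, a = if a = 1 then 1 else 0 := by decide
  obtain ⟨J, hJ, hz⟩ := exists_join (K := K) (S.filter fun z => t z = 1) (by
      rw [← ZMod.natCast_eq_zero_iff_even, Finset.card_filter]
      push_cast
      exact (Finset.sum_congr rfl fun z _ => (hbit _).symm).trans ht)
    (fun x hx y hy => hK x (Finset.mem_filter.1 hx).1 y (Finset.mem_filter.1 hy).1)
  refine ⟨J, hJ, fun z => ?_⟩
  rw [hz]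
  by_cases h : z ∈ S
  · simpa [h] using (hbit (t z)).symm
  · simp [h]

open Classical in
lemma ndeg_eq_ndeg_deleteIncidenceSet_add (G : SimpleGraph V) {v z : V} (hz : z ≠ v) :
    G.ndeg z = (G.deleteIncidenceSet v).ndeg z + if G.Adj v z then 1 else 0 := by
  set P : V → ℕ := fun z => if G.Adj v z then 1 else 0 with hP
  have hv : P v = 0 := by simp [hP]
  have hsup : G = G.deleteIncidenceSet v ⊔ spokes v P := by
    ext x y
    have := G.adj_comm x y
    simp only [sup_adj, deleteIncidenceSet_adj, spokes_adj hv]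
    have hv : ¬ G.Adj v v := G.irrefl
    simp only [hP]
    grind
  have hd : Disjoint (G.deleteIncidenceSet v) (spokes v P) := by
    rw [disjoint_left]
    intro x y
    rw [deleteIncidenceSet_adj, spokes_adj hv]
    tauto
  conv_lhs => rw [hsup]
  rw [ndeg_sup hd, ndeg_spokes_of_ne hv hz]
  simp only [hP]
  split_ifs <;> simp

open Classical in
lemma ndeg_eq_sum (G : SimpleGraph V) (v : V) : G.ndeg v = ∑ z, if G.Adj v z then 1 else 0 := by
  rw [ndeg_eq_degree, Finset.sum_boole, ← card_neighborFinset_eq_degree, neighborFinset_eq_filter]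
  rfl

omit [Fintype V] in
lemma reachable_deleteIncidenceSet {G : SimpleGraph V} {v : V}
    (h : (G.induce ({v}ᶜ : Set V)).Connected) {x y : V} (hx : x ≠ v) (hy : y ≠ v) :
    (G.deleteIncidenceSet v).Reachable x y := by
  refine Reachable.map (G := G.induce ({v}ᶜ : Set V)) ⟨Subtype.val, ?_⟩
    (h.preconnected ⟨x, hx⟩ ⟨y, hy⟩)
  rintro ⟨a, ha⟩ ⟨b, hb⟩ hab
  exact (G.deleteIncidenceSet_adj).2 ⟨hab, ha, hb⟩

omit [Fintype V] in
lemma reachable_deleteIncidenceSet_deleteIncidenceSet {G : SimpleGraph V} {v w : V}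
    (h : (G.induce ({v, w}ᶜ : Set V)).Connected) {x y : V} (hx : x ≠ v) (hxw : x ≠ w) (hy : y ≠ v)
    (hyw : y ≠ w) : ((G.deleteIncidenceSet v).deleteIncidenceSet w).Reachable x y := by
  refine Reachable.map (G := G.induce ({v, w}ᶜ : Set V)) ⟨Subtype.val, ?_⟩
    (h.preconnected ⟨x, by simp [hx, hxw]⟩ ⟨y, by simp [hy, hyw]⟩)
  rintro ⟨a, ha⟩ ⟨b, hb⟩ hab
  simp only [Set.mem_compl_iff, Set.mem_insert_iff, Set.mem_singleton_iff, not_or] at ha hb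
  rw [deleteIncidenceSet_adj, deleteIncidenceSet_adj]
  exact ⟨⟨hab, ha.1, hb.1⟩, ha.2, hb.2⟩

open Classical in
/-- A cut of `G - v`, both of whose sides are connected, with odd labels. -/
lemma exists_odd_bond {G : SimpleGraph V} {v : V}
    (hnocut : ∀ w, w ≠ v → (G.induce ({v, w}ᶜ : Set V)).Connected) {e n : V → ZMod 2}
    (hev : e v = 0) (hnv : n v = 0) (he : ∑ z, e z = 0) (hn : ∑ z, n z = 0)
    (hs : ∃ s, e s ≠ 0) (hp : ∃ p, n p ≠ 0) :
    ∃ A : Finset V, ∃ K ≤ G.deleteIncidenceSet v, v ∉ A ∧ (∀ x y, K.Adj x y → (x ∈ A ↔ y ∈ A)) ∧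
      (∀ x ∈ A, ∀ y ∈ A, K.Reachable x y) ∧
      (∀ x, x ∉ A → x ≠ v → ∀ y, y ∉ A → y ≠ v → K.Reachable x y) ∧
      ∑ z ∈ A, e z = 1 ∧ ∑ z ∈ A, n z = 1 := by
  have hsum : ∀ f : V → ZMod 2, f v = 0 → ∑ z, f z = 0 → ∑ z : {z // z ≠ v}, f z = 0 := by
    intro f hfv hf
    rw [← hf, ← Finset.sum_erase Finset.univ hfv]
    exact (Finset.sum_subtype _ (by simp) f).symm
  have hcut : ∀ w : {z // z ≠ v}, CutConn (fun a b : {z // z ≠ v} => G.Adj a b) {w}ᶜ := by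
    rintro ⟨w, hw⟩ X ⟨⟨a, hav⟩, ha, haX⟩ ⟨⟨b, hbv⟩, hb, hbX⟩
    have haw : a ≠ w := fun h => ha (Subtype.ext h)
    have hbw : b ≠ w := fun h => hb (Subtype.ext h)
    obtain ⟨_, ⟨x, hxX, rfl⟩, y, hyX, hxy⟩ :=
      (reachable_deleteIncidenceSet_deleteIncidenceSet (hnocut w hw) hav haw hbv
        hbw).exists_adj_crossing (X := Subtype.val '' X) ⟨_, haX, rfl⟩ (by simpa using fun _ => hbX)
    rw [deleteIncidenceSet_adj, deleteIncidenceSet_adj] at hxy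
    exact ⟨x, fun h => hxy.2.1 (congrArg _ h), ⟨y, hxy.1.2.2⟩, fun h => hxy.2.2 (congrArg Subtype.val h), hxX,
      fun h => hyX ⟨_, h, rfl⟩, hxy.1.1⟩
  obtain ⟨s, hs⟩ := hs
  obtain ⟨p, hp⟩ := hp
  obtain ⟨A, h1, h2, h3, h4⟩ := exists_odd_cut _ (U := {z // z ≠ v}) (r := fun a b => G.Adj a b)
    le_rfl (fun a b hab => hab.symm) hcut (fun z => e z) (fun z => n z) (hsum e hev he)
    (hsum n hnv hn) ⟨⟨s, by rintro rfl; exact hs hev⟩, hs⟩ ⟨⟨p, by rintro rfl; exact hp hnv⟩, hp⟩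
  let B : Finset V := A.map (Function.Embedding.subtype _)
  have hB : ∀ z : {z // z ≠ v}, z.1 ∈ B ↔ z ∈ A := by
    intro z
    simp [B, z.2]
  let K : SimpleGraph V := ⟨fun x y => (G.deleteIncidenceSet v).Adj x y ∧ (x ∈ B ↔ y ∈ B),
    ⟨fun x y h => ⟨h.1.symm, h.2.symm⟩⟩, ⟨fun x h => h.1.ne rfl⟩⟩
  have hK : ∀ a b : {z // z ≠ v}, G.Adj a b → (a ∈ A ↔ b ∈ A) → K.Adj a b := fun a b hab h =>
    ⟨(G.deleteIncidenceSet_adj).2 ⟨hab, a.2, b.2⟩, by rw [hB, hB]; exact h⟩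
  refine ⟨B, K, fun x y h => h.1, by simp [B], fun x y h => h.2, ?_, ?_, ?_, ?_⟩
  · intro x hx y hy
    have hxv : x ≠ v := by rintro rfl; simp [B] at hx
    have hyv : y ≠ v := by rintro rfl; simp [B] at hy
    exact reachable_of_cutConn (a := ⟨x, hxv⟩) (b := ⟨y, hyv⟩) h1 Subtype.val
      (fun a ha b hb hab => hK a b hab (iff_of_true ha hb)) ((hB ⟨x, hxv⟩).1 hx)
      ((hB ⟨y, hyv⟩).1 hy)
  · intro x hx hxv y hy hyv
    exact reachable_of_cutConn (a := ⟨x, hxv⟩) (b := ⟨y, hyv⟩) h2 Subtype.val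
      (fun a ha b hb hab => hK a b hab (iff_of_false ha hb)) (fun h => hx ((hB ⟨x, hxv⟩).2 h))
      (fun h => hy ((hB ⟨y, hyv⟩).2 h))
  · rw [← h3, Finset.sum_map]
    rfl
  · rw [← h4, Finset.sum_map]
    rfl

open Classical in
/-- The case in which the vertices of even degree other than `v` exist. -/
lemma hasOddCover_of_exists_even {G : SimpleGraph V} {v : V} (hodd : Odd (Fintype.card V))
    (hdeg : Even (G.ndeg v)) (hnbr : ∃ p, G.Adj v p)
    (hnocut : ∀ w, w ≠ v → (G.induce ({v, w}ᶜ : Set V)).Connected)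
    (heven : ∃ s, s ≠ v ∧ Even (G.ndeg s)) : G.HasOddCover := by
  have h2 : ∀ a : ZMod 2, a + a = 0 := by decide
  set e : V → ZMod 2 := fun z => if z = v then 0 else G.ndeg z + 1 with he
  set n : V → ZMod 2 := fun z => if G.Adj v z then 1 else 0 with hn
  have hnv : n v = 0 := by simp [hn]
  have hnsum : ∑ z, n z = 0 := by
    rw [← ZMod.natCast_eq_zero_iff_even, ndeg_eq_sum] at hdeg
    simp only [hn]
    exact_mod_cast hdeg
  have hesum : ∑ z, e z = 0 := by
    have h1 : ∀ z, e z = G.ndeg z + 1 + if z = v then 1 else 0 := by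
      intro z
      by_cases hz : z = v
      · subst hz
        rw [ZMod.natCast_eq_zero_iff_even.2 hdeg]
        simp [he, h2]
      · simp [he, hz]
    simp_rw [h1, Finset.sum_add_distrib]
    rw [sum_natCast_ndeg]
    simp only [Finset.sum_const, Finset.card_univ, nsmul_eq_mul, mul_one, Finset.sum_ite_eq',
      Finset.mem_univ, if_true, zero_add]
    rw [ZMod.natCast_eq_one_iff_odd.2 hodd]
    rfl
  obtain ⟨s, hsv, hs⟩ := heven
  obtain ⟨p, hp⟩ := hnbr
  obtain ⟨A, K, hK, hvA, hKA, hA, hB, heA, hnA⟩ := exists_odd_bond hnocut (e := e) (n := n)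
    (by simp [he]) hnv hesum hnsum
    ⟨s, by simp [he, hsv, ZMod.natCast_eq_zero_iff_even.2 hs]⟩ ⟨p, by simp [hn, hp]⟩
  obtain ⟨W, hWK, hW, hWr⟩ := K.exists_isAcyclic_reachable_eq_le
  have htA : ∑ z ∈ A, (e z + n z) = 0 := by
    rw [Finset.sum_add_distrib, heA, hnA]
    rfl
  have htB : ∑ z ∈ (insert v A)ᶜ, (e z + n z) = 0 := by
    have h := Finset.sum_add_sum_compl (insert v A) fun z => e z + n z
    rw [Finset.sum_add_distrib (s := Finset.univ), hesum, hnsum, Finset.sum_insert hvA, htA, hnv] at h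
    simpa [he] using h
  obtain ⟨JA, hJA, hJAz⟩ := exists_join_of_sum_eq_zero (K := W) A _ htA (by
    rw [hWr]
    exact hA)
  obtain ⟨JB, hJB, hJBz⟩ := exists_join_of_sum_eq_zero (K := W) _ _ htB (by
    rw [hWr]
    simp only [Finset.mem_compl, Finset.mem_insert, not_or]
    exact fun x hx y hy => hB x hx.2 hx.1 y hy.2 hy.1)
  set J := symmDiff JA JB with hJ
  have hJW : J ≤ W := symmDiff_le_sup.trans (sup_le hJA hJB)
  have hJK : J ≤ K := hJW.trans hWK
  have hJH : J ≤ G.deleteIncidenceSet v := hJK.trans hK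
  have hJz : ∀ z, z ≠ v → (J.ndeg z : ZMod 2) = e z + n z := by
    intro z hz
    rw [hJ, natCast_ndeg_symmDiff, hJAz, hJBz]
    by_cases hzA : z ∈ A <;> simp [hzA, hz]
  obtain ⟨C, D, P, Q, h⟩ := (hW.anti hJW).exists_oddSplit fun z => if G.Adj v z then 1 else 0
  have hPQ : ∀ z, (P z : ZMod 2) + Q z = n z := by
    intro z
    have := h.add_eq z
    simp only [hn]
    rw [← Nat.cast_add, this]
    split_ifs <;> simp
  have finish : ∀ C D P Q, OddSplit J C D (fun z => if G.Adj v z then 1 else 0) P Q →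
      Odd (∑ z, P z) → G.HasOddCover := by
    intro C D P Q h hP
    have hQ : Odd (∑ z, Q z) := by
      have h1 : ∑ z, P z + ∑ z, Q z = G.ndeg v := by
        rw [← Finset.sum_add_distrib, ndeg_eq_sum]
        exact Finset.sum_congr rfl fun z _ => h.add_eq z
      grind
    refine h.hasOddCover (F := G.deleteIncidenceSet v \ J) (f := s(v, v)) ?_ ?_ ?_ ?_ ?_ hP hQ
    · intro x y hx hy
      have h1 := @hJH x y
      rw [deleteIncidenceSet_adj] at h1
      rw [sdiff_adj, deleteIncidenceSet_adj]
      by_cases hxy : J.Adj x y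
      · simp [hxy, (h1 hxy).1]
      · simp [hxy, hx, hy]
    · intro z hz
      rw [sdiff_adj, deleteIncidenceSet_adj] at hz
      exact hz.1.2.1 rfl
    · intro z hz
      exact ((G.deleteIncidenceSet_adj).1 (hJH hz)).2.1 rfl
    · intro x y hxy hJxy
      exact absurd hJxy hxy.2
    · intro z hz
      have h1 := congrArg (Nat.cast : ℕ → ZMod 2) (G.ndeg_eq_ndeg_deleteIncidenceSet_add hz)
      rw [← ZMod.natCast_eq_one_iff_odd, natCast_ndeg_sdiff hJH, hJz z hz]
      simp only [he, hn, hz, if_false]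
      push_cast at h1
      rw [h1]
      generalize ((G.deleteIncidenceSet v).ndeg z : ZMod 2) = a
      generalize (if G.Adj v z then (1 : ZMod 2) else 0) = b
      revert a b
      decide
  by_cases hPodd : Odd (∑ z, P z)
  · exact finish C D P Q h hPodd
  · obtain ⟨C', D', h'⟩ := h.swap_on (A := (A : Set V)) fun x y hxy => hKA x y (hJK hxy)
    refine finish _ _ _ _ h' ?_
    rw [Nat.not_odd_iff_even, ← ZMod.natCast_eq_zero_iff_even] at hPodd
    push_cast at hPodd
    have hsw : ∀ z, ((if z ∈ (A : Set V) then Q z else P z : ℕ) : ZMod 2) =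
        P z + if z ∈ A then n z else 0 := by
      intro z
      rw [← hPQ z]
      by_cases hz : z ∈ A
      · simp [hz, ← add_assoc, h2]
      · simp [hz]
    rw [← ZMod.natCast_eq_one_iff_odd, Nat.cast_sum]
    refine (Finset.sum_congr rfl fun z _ => by convert hsw z).trans ?_
    rw [Finset.sum_add_distrib, hPodd, zero_add, Finset.sum_ite_mem, Finset.univ_inter, hnA]

open Classical in
/-- The case in which `v` is the only vertex of even degree and has a non-neighbour. -/
lemma hasOddCover_of_exists_not_adj {G : SimpleGraph V} {v : V}
    (hdeg : Even (G.ndeg v)) (hnbr : ∃ p, G.Adj v p)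
    (hconn : (G.induce ({v}ᶜ : Set V)).Connected)
    (hnocut : ∀ w, w ≠ v → (G.induce ({v, w}ᶜ : Set V)).Connected)
    (hGodd : ∀ z, z ≠ v → Odd (G.ndeg z)) (hx : ∃ x, x ≠ v ∧ ¬ G.Adj v x) : G.HasOddCover := by
  obtain ⟨x, hxv, hvx⟩ := hx
  set n : V → ZMod 2 := fun z => if G.Adj v z then 1 else 0 with hn
  have hnsum : ∑ z, n z = 0 := by
    rw [← ZMod.natCast_eq_zero_iff_even, ndeg_eq_sum] at hdeg
    simp only [hn]
    exact_mod_cast hdeg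
  have htS : ∑ z ∈ ({v, x} : Finset V)ᶜ, n z = 0 := by
    rw [← hnsum]
    refine Finset.sum_subset (Finset.subset_univ _) fun z _ hz => ?_
    simp only [Finset.mem_compl, Finset.mem_insert, Finset.mem_singleton, not_not] at hz
    rcases hz with rfl | rfl <;> simp [hn, hvx]
  set H := G.deleteIncidenceSet v with hH
  set K := H.deleteIncidenceSet x with hK
  obtain ⟨W, hWK, hW, hWr⟩ := K.exists_isAcyclic_reachable_eq_le
  obtain ⟨J, hJW, hJz⟩ := exists_join_of_sum_eq_zero (K := W) _ _ htS (by
    rw [hWr]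
    simp only [Finset.mem_compl, Finset.mem_insert, Finset.mem_singleton, not_or]
    exact fun a ha b hb => reachable_deleteIncidenceSet_deleteIncidenceSet (hnocut x hxv)
      ha.1 ha.2 hb.1 hb.2)
  have hJn : ∀ z, (J.ndeg z : ZMod 2) = n z := by
    intro z
    rw [hJz]
    split_ifs with hz
    · rfl
    · simp only [Finset.mem_compl, Finset.mem_insert, Finset.mem_singleton, not_not] at hz
      rcases hz with rfl | rfl <;> simp [hn, hvx]
  have hJK : J ≤ K := hJW.trans hWK
  have hJH : J ≤ H := hJK.trans (H.deleteIncidenceSet_le x)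
  have hJx : ∀ z, ¬ J.Adj x z := fun z hz => ((H.deleteIncidenceSet_adj).1 (hJK hz)).2.1 rfl
  have finish : ∀ J' C D P Q f, OddSplit J' C D (fun z => if G.Adj v z then 1 else 0) P Q →
      J ≤ J' → J' ≤ H → (∀ a b, H.Adj a b → ¬ J.Adj a b → J'.Adj a b → s(a, b) = f) →
      Odd (∑ z, P z) → G.HasOddCover := by
    intro J' C D P Q f h hJJ' hJ'H hf hP
    have hQ : Odd (∑ z, Q z) := by
      have h1 : ∑ z, P z + ∑ z, Q z = G.ndeg v := by
        rw [← Finset.sum_add_distrib, ndeg_eq_sum]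
        exact Finset.sum_congr rfl fun z _ => h.add_eq z
      grind
    refine h.hasOddCover (F := H \ J) (f := f) ?_ ?_ ?_ ?_ ?_ hP hQ
    · intro a b ha hb
      have h1 := @hJ'H a b
      have h2 := @hJJ' a b
      rw [deleteIncidenceSet_adj] at h1
      rw [sdiff_adj, deleteIncidenceSet_adj]
      by_cases hab : J'.Adj a b
      · simp [hab, (h1 hab).1]
      · have h3 : ¬ J.Adj a b := fun h => hab (h2 h)
        simp [hab, h3, ha, hb]
    · intro z hz
      rw [sdiff_adj, deleteIncidenceSet_adj] at hz
      exact hz.1.2.1 rfl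
    · intro z hz
      exact ((G.deleteIncidenceSet_adj).1 (hJ'H hz)).2.1 rfl
    · intro a b hab hJab
      exact hf a b hab.1 hab.2 hJab
    · intro z hz
      have h1 := congrArg (Nat.cast : ℕ → ZMod 2) (G.ndeg_eq_ndeg_deleteIncidenceSet_add hz)
      rw [ZMod.natCast_eq_one_iff_odd.2 (hGodd z hz)] at h1
      rw [← ZMod.natCast_eq_one_iff_odd, natCast_ndeg_sdiff hJH, hJn z, h1]
      push_cast
      rfl
  have htot : ∀ z, Even (J.ndeg z + if G.Adj v z then 1 else 0) := by
    intro z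
    rw [← ZMod.natCast_eq_zero_iff_even]
    push_cast
    rw [hJn]
    simp only [hn]
    split_ifs <;> decide
  have hsum : ∀ (C : SimpleGraph V) (P : V → ℕ) (S : Finset V),
      (∀ z, z ∈ S → Odd (C.ndeg z + P z)) → (∀ z, z ∉ S → Even (C.ndeg z + P z)) →
      Odd S.card → Odd (∑ z, P z) := by
    intro C P S h1 h2 hS
    have h3 : ∀ z, ((C.ndeg z : ZMod 2) + P z) = if z ∈ S then 1 else 0 := by
      intro z
      rw [← Nat.cast_add]
      split_ifs with hz
      · exact ZMod.natCast_eq_one_iff_odd.2 (h1 z hz)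
      · exact ZMod.natCast_eq_zero_iff_even.2 (h2 z hz)
    rw [← ZMod.natCast_eq_one_iff_odd] at hS ⊢
    rw [Nat.cast_sum, ← zero_add (∑ z, (P z : ZMod 2)), ← sum_natCast_ndeg C,
      ← Finset.sum_add_distrib, Finset.sum_congr rfl fun z _ => h3 z, Finset.sum_ite_mem,
      Finset.univ_inter, Finset.sum_const, nsmul_eq_mul, mul_one, hS]
  set S : Finset V := Finset.univ.filter fun z => J.ndeg z + (if G.Adj v z then 1 else 0) ≠ 0
    with hS
  have hmem : ∀ z, z ∈ S ↔ J.ndeg z + (if G.Adj v z then 1 else 0) ≠ 0 := fun z => by simp [hS]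
  by_cases hcard : Odd S.card
  · obtain ⟨C, D, P, Q, h⟩ := (hW.anti hJW).exists_oddSplit fun z => if G.Adj v z then 1 else 0
    refine finish J C D P Q s(v, v) h le_rfl hJH (fun a b _ h1 h2 => absurd h2 h1) ?_
    refine hsum C P S (fun z hz => ?_) (fun z hz => ?_) hcard <;>
    · have h1 := h.add_eq z
      have h2 := htot z
      have h3 := h.left z
      have h4 := h.right z
      have h5 := ndeg_sup h.disjoint z
      rw [h.sup_eq] at h5
      rw [hmem] at hz
      grind
  · obtain ⟨p, hp⟩ := hnbr
    have hxS : x ∉ S := by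
      rw [hmem]
      simp [hvx, ndeg_eq_zero_iff, hJx]
    obtain ⟨b, hbS, a, haS, hba⟩ := (reachable_deleteIncidenceSet hconn hp.ne' hxv).exists_adj_crossing
      (X := (S : Set V)) (by rw [Finset.mem_coe, hmem]; simp [hp]) (by simpa using hxS)
    rw [Finset.mem_coe] at hbS haS
    have hne : a ≠ b := hba.ne'
    have haJ : ∀ z, ¬ J.Adj a z := by
      rw [← ndeg_eq_zero_iff]
      rw [hmem] at haS
      omega
    have hdis : Disjoint J (edge a b) := (disjoint_edge J).2 (haJ b)
    have hacyc : (J ⊔ edge a b).IsAcyclic := by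
      refine (hW.anti hJW).sup_edge_of_not_reachable fun h => ?_
      obtain ⟨_, rfl, y, _, hy⟩ := h.exists_adj_crossing (X := {a}) rfl (fun h => hne h.symm)
      exact haJ y hy
    obtain ⟨C, D, P, Q, h⟩ := hacyc.exists_oddSplit fun z => if G.Adj v z then 1 else 0
    have key : ∀ C D P Q,
        OddSplit (J ⊔ edge a b) C D (fun z => if G.Adj v z then 1 else 0) P Q → C.Adj a b →
        Odd (∑ z, Q z) := by
      intro C D P Q h hC
      have hnd : ∀ z, C.ndeg z + D.ndeg z = J.ndeg z + (edge a b).ndeg z := by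
        intro z
        rw [← ndeg_sup h.disjoint, ← ndeg_sup hdis, h.sup_eq]
      have hCa : C.ndeg a ≠ 0 := fun h0 => ndeg_eq_zero_iff.1 h0 b hC
      have hCb : C.ndeg b ≠ 0 := fun h0 => ndeg_eq_zero_iff.1 h0 a hC.symm
      refine hsum D Q (S.erase b) (fun z hz => ?_) (fun z hz => ?_) ?_
      · rw [Finset.mem_erase] at hz
        have hza : z ≠ a := fun h => haS (h ▸ hz.2)
        have h1 := h.add_eq z
        have h2 := htot z
        have h3 := h.left z
        have h4 := h.right z
        have h5 := hnd z
        rw [ndeg_edge_of_ne hza hz.1] at h5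
        have h6 := (hmem z).1 hz.2
        grind
      · have h1 := h.add_eq z
        have h2 := htot z
        have h3 := h.left z
        have h4 := h.right z
        have h5 := hnd z
        by_cases hzb : z = b
        · subst hzb
          rw [ndeg_edge_right hne] at h5
          grind
        · have hzS : z ∉ S := fun h => hz (Finset.mem_erase.2 ⟨hzb, h⟩)
          rw [hmem] at hzS
          by_cases hza : z = a
          · subst hza
            rw [ndeg_edge_left hne] at h5
            grind
          · rw [ndeg_edge_of_ne hza hzb] at h5
            grind
      · rw [Finset.card_erase_of_mem hbS]
        have := Finset.card_pos.2 ⟨b, hbS⟩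
        grind
    have hfin : ∀ C D P Q,
        OddSplit (J ⊔ edge a b) C D (fun z => if G.Adj v z then 1 else 0) P Q →
        Odd (∑ z, P z) → G.HasOddCover := by
      intro C D P Q h hP
      refine finish (J ⊔ edge a b) C D P Q s(a, b) h le_sup_left
        (sup_le hJH ((edge_le_iff H).2 (Or.inr hba.symm))) (fun y z _ h1 h2 => ?_) hP
      rw [sup_adj, edge_adj] at h2
      rcases h2 with h2 | h2
      · exact absurd h2 h1
      · rw [Sym2.eq_iff]
        tauto
    have hab : C.Adj a b ∨ D.Adj a b := by
      rw [← sup_adj, h.sup_eq, sup_adj, edge_adj]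
      exact Or.inr ⟨Or.inl ⟨rfl, rfl⟩, hne⟩
    rcases hab with hab | hab
    · exact hfin _ _ _ _ h.symm (key _ _ _ _ h hab)
    · exact hfin _ _ _ _ h (key _ _ _ _ h.symm hab)

open Classical in
/-- The case in which `v` is the only vertex of even degree and is adjacent to all others. -/
lemma hasOddCover_of_forall_adj {G : SimpleGraph V} {v : V} (hodd : Odd (Fintype.card V))
    (hdeg : Even (G.ndeg v)) (hnbr : ∃ p, G.Adj v p)
    (hnocut : ∀ w, w ≠ v → (G.induce ({v, w}ᶜ : Set V)).Connected)
    (hGodd : ∀ z, z ≠ v → Odd (G.ndeg z)) (hv : ∀ z, z ≠ v → G.Adj v z) : G.HasOddCover := by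
  obtain ⟨u, hvu⟩ := hnbr
  have huv : u ≠ v := hvu.ne'
  obtain ⟨x, hxu, hux⟩ : ∃ x, x ≠ u ∧ ¬ G.Adj u x := by
    by_contra! hc
    have h1 : G.neighborSet u = ↑(Finset.univ.erase u) := by
      ext z
      simp only [mem_neighborSet, Finset.coe_erase, Finset.coe_univ, Set.mem_sdiff, Set.mem_univ,
        true_and, Set.mem_singleton_iff]
      exact ⟨fun h => h.ne', hc z⟩
    have h2 := hGodd u huv
    rw [ndeg, h1, Set.ncard_coe_finset, Finset.card_erase_of_mem (Finset.mem_univ _),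
      Finset.card_univ] at h2
    have := Fintype.card_pos_iff.2 ⟨u⟩
    grind
  have hxv : x ≠ v := by
    rintro rfl
    exact hux hvu.symm
  have hxu' : ¬ G.Adj x u := fun h => hux h.symm
  let C₁ : SimpleGraph V := fromRel fun a b =>
    (a = x ∧ G.Adj x b) ∨ (a = v ∧ b ≠ u ∧ b ≠ x ∧ ¬ G.Adj x b)
  have hC₁ : ∀ a b, C₁.Adj a b ↔ a ≠ b ∧ (((a = x ∧ G.Adj x b) ∨
      (a = v ∧ b ≠ u ∧ b ≠ x ∧ ¬ G.Adj x b)) ∨ ((b = x ∧ G.Adj x a) ∨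
      (b = v ∧ a ≠ u ∧ a ≠ x ∧ ¬ G.Adj x a))) := fun a b => Iff.rfl
  have hC₁G : C₁ ≤ G := by
    intro a b
    rw [hC₁]
    rintro ⟨hab, (⟨rfl, h⟩ | ⟨rfl, h⟩) | ⟨rfl, h⟩ | ⟨rfl, h⟩⟩
    · exact h
    · exact hv b hab.symm
    · exact h.symm
    · exact (hv a hab).symm
  have hC₁u : C₁.ndeg u = 0 := by
    rw [ndeg_eq_zero_iff]
    intro w
    rw [hC₁]
    grind
  have hC₁x : ∀ w, C₁.Adj x w ↔ G.Adj x w := by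
    intro w
    rw [hC₁]
    have h1 : ¬ G.Adj x x := G.irrefl
    have h2 : G.Adj x w → x ≠ w := fun h => h.ne
    grind
  have hC₁z : ∀ z, z ≠ u → z ≠ v → z ≠ x → C₁.ndeg z = 1 := by
    intro z hzu hzv hzx
    rw [ndeg, Set.ncard_eq_one]
    have h1 : G.Adj x v := (hv x hxv).symm
    by_cases hz : G.Adj x z
    · refine ⟨x, ?_⟩
      ext w
      rw [mem_neighborSet, hC₁, Set.mem_singleton_iff]
      grind
    · refine ⟨v, ?_⟩
      ext w
      rw [mem_neighborSet, hC₁, Set.mem_singleton_iff]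
      grind
  have hcard : (Fintype.card V : ZMod 2) = 1 := ZMod.natCast_eq_one_iff_odd.2 hodd
  have hC₁v : (C₁.ndeg v : ZMod 2) = 1 := by
    have h1 : ∀ z, (C₁.ndeg z : ZMod 2) = 1 + ((if z = u then 1 else 0) +
        if z = v then 1 + (C₁.ndeg v : ZMod 2) else 0) := by
      intro z
      by_cases hzu : z = u
      · subst hzu
        rw [hC₁u]
        simp [huv]
        decide
      · by_cases hzv : z = v
        · subst hzv
          simp only [hzu, if_false, if_true, zero_add]
          rw [← add_assoc, show (1 : ZMod 2) + 1 = 0 from rfl, zero_add]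
        · by_cases hzx : z = x
          · subst hzx
            rw [ndeg_congr (hC₁x), ZMod.natCast_eq_one_iff_odd.2 (hGodd z hzv)]
            simp [hzu, hzv]
          · rw [hC₁z z hzu hzv hzx]
            simp [hzu, hzv]
    have h2 := sum_natCast_ndeg C₁
    rw [Finset.sum_congr rfl fun z _ => h1 z, Finset.sum_add_distrib, Finset.sum_add_distrib] at h2
    simp only [Finset.sum_const, Finset.card_univ, nsmul_eq_mul, mul_one, Finset.sum_ite_eq',
      Finset.mem_univ, if_true, hcard] at h2
    generalize (C₁.ndeg v : ZMod 2) = a at h2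
    revert a
    decide
  set K := (G.deleteIncidenceSet v).deleteIncidenceSet x with hK
  have hKadj : ∀ a b, K.Adj a b ↔ G.Adj a b ∧ a ≠ v ∧ b ≠ v ∧ a ≠ x ∧ b ≠ x := by
    intro a b
    rw [hK, deleteIncidenceSet_adj, deleteIncidenceSet_adj]
    tauto
  have htS : ∑ z ∈ ({v, x} : Finset V)ᶜ, (if z = u then (0 : ZMod 2) else 1) = 0 := by
    have h := Finset.sum_add_sum_compl {v, x} fun z => if z = u then (0 : ZMod 2) else 1
    have h1 : ∀ z, (if z = u then (0 : ZMod 2) else 1) = 1 + if z = u then 1 else 0 := by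
      intro z
      split_ifs <;> rfl
    rw [Finset.sum_pair hxv.symm, if_neg huv.symm, if_neg hxu,
      Finset.sum_congr (s₁ := Finset.univ) rfl fun z _ => h1 z, Finset.sum_add_distrib] at h
    simp only [Finset.sum_const, Finset.card_univ, nsmul_eq_mul, mul_one, Finset.sum_ite_eq',
      Finset.mem_univ, if_true, hcard] at h
    rwa [show (1 : ZMod 2) + 1 = 0 from rfl, zero_add] at h
  obtain ⟨X, hXK, hXz⟩ := exists_join_of_sum_eq_zero (K := K) _ _ htS (by
    simp only [Finset.mem_compl, Finset.mem_insert, Finset.mem_singleton, not_or]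
    exact fun a ha b hb => reachable_deleteIncidenceSet_deleteIncidenceSet (hnocut x hxv)
      ha.1 ha.2 hb.1 hb.2)
  have hX : ∀ a b, X.Adj a b → G.Adj a b ∧ a ≠ v ∧ b ≠ v ∧ a ≠ x ∧ b ≠ x := fun a b h =>
    (hKadj a b).1 (hXK h)
  have hXv : X.ndeg v = 0 := ndeg_eq_zero_iff.2 fun w h => (hX v w h).2.1 rfl
  have hXx : X.ndeg x = 0 := ndeg_eq_zero_iff.2 fun w h => (hX x w h).2.2.2.1 rfl
  have hXu : (X.ndeg u : ZMod 2) = 0 := by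
    rw [hXz]
    simp
  have hXo : ∀ z, z ≠ u → z ≠ v → z ≠ x → (X.ndeg z : ZMod 2) = 1 := by
    intro z hzu hzv hzx
    rw [hXz]
    simp [hzu, hzv, hzx]
  have hC₁X : ∀ a b, C₁.Adj a b → ¬ X.Adj a b := by
    intro a b h1 h2
    have h3 := hX a b h2
    rw [hC₁] at h1
    tauto
  have hXC : X ≤ G \ C₁ := fun a b h => ⟨(hX a b h).1, fun h' => hC₁X a b h' h⟩
  have hX' : Disjoint X (edge u v) := (disjoint_edge X).2 fun h => (hX u v h).2.2.1 rfl
  have hCe : ∀ a b, C₁.Adj a b → ¬ (edge u v).Adj a b := by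
    intro a b h1 h2
    rw [edge_adj] at h2
    rw [hC₁] at h1
    grind
  have hnd₃ : ∀ z, (((G \ C₁) \ X).ndeg z : ZMod 2) = G.ndeg z + C₁.ndeg z + X.ndeg z := by
    intro z
    rw [natCast_ndeg_sdiff hXC, natCast_ndeg_sdiff hC₁G]
  refine ⟨![C₁, X ⊔ edge u v, (G \ C₁) \ X], s(u, v), ?_, ?_, ?_, 0, ?_⟩
  · intro a b
    have h1 := @hC₁G a b
    have h2 := hX a b
    have h3 : (edge u v).Adj a b → G.Adj a b := fun h => (edge_le_iff G).2 (Or.inr hvu.symm) h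
    simp only [Fin.exists_fin_succ, Matrix.cons_val_zero, Matrix.cons_val_succ, sup_adj, sdiff_adj,
      IsEmpty.exists_iff, or_false]
    tauto
  · intro j z
    fin_cases j
    · change C₁.ndeg z = 0 ∨ Odd (C₁.ndeg z)
      by_cases hzu : z = u
      · exact Or.inl (hzu ▸ hC₁u)
      · by_cases hzv : z = v
        · exact Or.inr (hzv ▸ ZMod.natCast_eq_one_iff_odd.1 hC₁v)
        · by_cases hzx : z = x
          · subst hzx
            rw [ndeg_congr (hC₁x)]
            exact Or.inr (hGodd z hzv)
          · rw [hC₁z z hzu hzv hzx]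
            exact Or.inr odd_one
    · change (X ⊔ edge u v).ndeg z = 0 ∨ Odd ((X ⊔ edge u v).ndeg z)
      rw [ndeg_sup hX']
      by_cases hzu : z = u
      · subst hzu
        rw [ndeg_edge_left huv]
        rw [ZMod.natCast_eq_zero_iff_even] at hXu
        exact Or.inr hXu.add_one
      · by_cases hzv : z = v
        · subst hzv
          rw [ndeg_edge_right huv, hXv]
          exact Or.inr odd_one
        · rw [ndeg_edge_of_ne hzu hzv, add_zero]
          by_cases hzx : z = x
          · exact Or.inl (hzx ▸ hXx)
          · exact Or.inr (ZMod.natCast_eq_one_iff_odd.1 (hXo z hzu hzv hzx))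
    · change ((G \ C₁) \ X).ndeg z = 0 ∨ Odd (((G \ C₁) \ X).ndeg z)
      by_cases hzx : z = x
      · left
        subst hzx
        rw [ndeg_eq_zero_iff]
        intro w h
        rw [sdiff_adj, sdiff_adj, hC₁x] at h
        exact h.1.2 h.1.1
      · right
        rw [← ZMod.natCast_eq_one_iff_odd, hnd₃]
        by_cases hzv : z = v
        · subst hzv
          rw [ZMod.natCast_eq_zero_iff_even.2 hdeg, hC₁v, hXv]
          rfl
        · rw [ZMod.natCast_eq_one_iff_odd.2 (hGodd z hzv)]
          by_cases hzu : z = u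
          · subst hzu
            rw [hC₁u, hXu]
            rfl
          · rw [hC₁z z hzu hzv hzx, hXo z hzu hzv hzx]
            rfl
  · have h01 : ∀ a b, C₁.Adj a b → (X ⊔ edge u v).Adj a b → False := by
      intro a b h1 h2
      exact h2.elim (hC₁X a b h1) (hCe a b h1)
    have h02 : ∀ a b, C₁.Adj a b → ((G \ C₁) \ X).Adj a b → False := fun a b h1 h2 => h2.1.2 h1
    have h12 : ∀ a b, (X ⊔ edge u v).Adj a b → ((G \ C₁) \ X).Adj a b → s(a, b) = s(u, v) := by
      intro a b h1 h2
      rcases h1 with h1 | h1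
      · exact absurd h1 h2.2
      · rw [edge_adj] at h1
        rw [Sym2.eq_iff]
        tauto
    intro i j a b hij
    have h1 := h01 a b
    have h2 := h02 a b
    have h3 := h12 a b
    fin_cases i <;> fin_cases j <;> simp at hij ⊢ <;> grind
  · change ¬ C₁.Adj u v
    exact fun h => ndeg_eq_zero_iff.1 hC₁u v h

end SimpleGraph

/-- Let `G` be a connected simple graph of odd order, `v` a vertex of even degree that
is not a cut vertex, such that `G − v` has no cut vertex. Then `G` admits an odd
3-edge-covering with overlap at most 2. -/
theorem stmt_15 {V : Type*} [Fintype V] [DecidableEq V] (G : SimpleGraph V)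
    [DecidableRel G.Adj]
    (hG : G.Connected) (hodd : Odd (Fintype.card V)) (v : V)
    (hdeg : Even (G.degree v))
    (hnotcut : (G.induce ({v}ᶜ : Set V)).Connected)
    (hnocut : ∀ w : V, w ≠ v → (G.induce (({v, w}ᶜ : Set V))).Connected) :
    ∃ ψ : Sym2 V → Finset (Fin 3),
      (∀ e ∈ G.edgeSet, (ψ e).Nonempty) ∧
      (∀ (j : Fin 3) (u : V),
        {e | e ∈ G.edgeSet ∧ j ∈ ψ e ∧ u ∈ e}.ncard = 0 ∨
          Odd {e | e ∈ G.edgeSet ∧ j ∈ ψ e ∧ u ∈ e}.ncard) ∧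
      (∑ e ∈ G.edgeFinset, (if 2 ≤ (ψ e).card then (ψ e).card else 0)) ≤ 2 := by
  apply SimpleGraph.HasOddCover.exists_covering
  rw [← SimpleGraph.ndeg_eq_degree] at hdeg
  have hnbr : ∃ p, G.Adj v p := by
    obtain ⟨q, hq⟩ := hnotcut.nonempty
    obtain ⟨_, rfl, y, _, hy⟩ := (hG.preconnected v q).exists_adj_crossing (X := {v}) rfl hq
    exact ⟨y, hy⟩
  by_cases heven : ∃ s, s ≠ v ∧ Even (G.ndeg s)
  · exact SimpleGraph.hasOddCover_of_exists_even hodd hdeg hnbr hnocut heven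
  · push Not at heven
    have hGodd : ∀ z, z ≠ v → Odd (G.ndeg z) := fun z hz => Nat.not_even_iff_odd.1 (heven z hz)
    by_cases hx : ∃ x, x ≠ v ∧ ¬ G.Adj v x
    · exact SimpleGraph.hasOddCover_of_exists_not_adj hdeg hnbr hnotcut hnocut hGodd hx
    · push Not at hx
      exact SimpleGraph.hasOddCover_of_forall_adj hodd hdeg hnbr hnocut hGodd hx
end

section
/- Let G be a connected simple graph of odd order, let v be a vertex of even degree, and let w be a neighbor of v of even degree such that w is not a cut vertex of G − v. Then G admits an odd 3-edge-coloring. -/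
/-- The boundary over `ZMod 2` of the multiset of edges of a walk is the sum of its endpoints. -/
theorem SimpleGraph.Walk.sum_count_edges_filter_mem {V : Type*} [Fintype V] [DecidableEq V]
    {G : SimpleGraph V} {a b : V} (p : G.Walk a b) (u : V) :
    ∑ e : Sym2 V with u ∈ e, (p.edges.count e : ZMod 2) =
      (if u = a then 1 else 0) + (if u = b then 1 else 0) := by
  induction p with
  | nil => simp [CharTwo.add_self_eq_zero]
  | @cons a b c h p ih =>
    have hab : a ≠ b := h.ne
    have hsum : ∑ e : Sym2 V with u ∈ e, (if s(a, b) = e then (1 : ZMod 2) else 0) =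
        (if u = a then 1 else 0) + (if u = b then 1 else 0) := by
      rw [Finset.sum_ite_eq]
      simp only [Finset.mem_filter, Finset.mem_univ, true_and, Sym2.mem_iff]
      by_cases h1 : u = a <;> by_cases h2 : u = b <;> simp_all
    simp only [SimpleGraph.Walk.edges_cons, List.count_cons, beq_iff_eq, Nat.cast_add,
      Nat.cast_ite, Nat.cast_one, Nat.cast_zero, Finset.sum_add_distrib, ih, hsum]
    linear_combination CharTwo.add_self_eq_zero (if u = b then (1 : ZMod 2) else 0)

/-- The sum of an edge labelling along a walk, in terms of edge multiplicities. -/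
theorem SimpleGraph.Walk.sum_map_edges {V : Type*} [Fintype V] [DecidableEq V]
    {G : SimpleGraph V} {a b : V} (p : G.Walk a b) (g : Sym2 V → ZMod 2) :
    (p.edges.map g).sum = ∑ e : Sym2 V, (p.edges.count e : ZMod 2) * g e := by
  induction p.edges with
  | nil => simp
  | cons e l ih =>
    simp [List.count_cons, ih, add_mul, Finset.sum_add_distrib, ite_mul, add_comm]

/-- A `T`-join exists whenever `T` is an even subset of a set of mutually reachable vertices. -/
theorem SimpleGraph.exists_join_s16 {V : Type*} [Fintype V] [DecidableEq V] (K : SimpleGraph V)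
    (t : V → ZMod 2) (hK : ∀ a b, t a ≠ 0 → t b ≠ 0 → K.Reachable a b) (ht : ∑ u, t u = 0) :
    ∃ x : Sym2 V → ZMod 2, (∀ e, x e ≠ 0 → e ∈ K.edgeSet) ∧
      ∀ u, ∑ e : Sym2 V with u ∈ e, x e = t u := by
  classical
  by_cases h0 : ∃ r, t r ≠ 0
  · obtain ⟨r, hr⟩ := h0
    let q : V → Sym2 V → ZMod 2 := fun b e =>
      if h : t b ≠ 0 then ((hK r b hr h).some.edges.count e : ZMod 2) else 0
    have hq : ∀ b u, t b * ∑ e : Sym2 V with u ∈ e, q b e =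
        t b * ((if u = r then 1 else 0) + (if u = b then 1 else 0)) := by
      intro b u
      by_cases h : t b = 0
      · simp [h]
      · simp only [q, ne_eq, h, not_false_eq_true, dite_true,
          SimpleGraph.Walk.sum_count_edges_filter_mem]
    refine ⟨fun e => ∑ b, t b * q b e, ?_, ?_⟩
    · intro e he
      obtain ⟨b, -, hb⟩ := Finset.exists_ne_zero_of_sum_ne_zero he
      have hb0 := left_ne_zero_of_mul hb
      refine (hK r b hr hb0).some.edges_subset_edgeSet
        (List.count_pos_iff.1 (Nat.pos_of_ne_zero fun h => ?_))
      simp [q, h] at hb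
    · intro u
      rw [Finset.sum_comm]
      simp only [← Finset.mul_sum, hq]
      simp [mul_add, Finset.sum_add_distrib, ht]
  · push Not at h0
    exact ⟨0, by simp, by simp [h0]⟩

open Finset in
/-- A `T`-join whose complement is acyclic, in the sense that every `ZMod 2`-labelling of the
edges of the complement is a coboundary. -/
theorem SimpleGraph.exists_join_coboundary {V : Type*} [Fintype V] [DecidableEq V]
    (K : SimpleGraph V) (t : V → ZMod 2)
    (hK : ∀ a b, t a ≠ 0 → t b ≠ 0 → K.Reachable a b) (ht : ∑ u, t u = 0) :
    ∃ x : Sym2 V → ZMod 2, (∀ e, x e ≠ 0 → e ∈ K.edgeSet) ∧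
      (∀ u, ∑ e : Sym2 V with u ∈ e, x e = t u) ∧
      ∀ g : Sym2 V → ZMod 2, ∃ s : V → ZMod 2,
        ∀ a b, K.Adj a b → x s(a, b) = 0 → s a + s b = g s(a, b) := by
  classical
  obtain ⟨x, hx, hmax⟩ := Finset.exists_max_image
    (univ.filter fun x : Sym2 V → ZMod 2 => (∀ e, x e ≠ 0 → e ∈ K.edgeSet) ∧
      ∀ u, ∑ e : Sym2 V with u ∈ e, x e = t u)
    (fun x => #{e | x e ≠ 0})
    (by obtain ⟨x, hx⟩ := K.exists_join_s16 t hK ht; exact ⟨x, by simpa using hx⟩)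
  simp only [Finset.mem_filter, Finset.mem_univ, true_and] at hx hmax
  refine ⟨x, hx.1, hx.2, fun g => ?_⟩
  let J : SimpleGraph V := SimpleGraph.fromEdgeSet {e | e ∈ K.edgeSet ∧ x e = 0}
  have hJe : ∀ e ∈ J.edgeSet, e ∈ K.edgeSet ∧ x e = 0 := by
    intro e he
    simp only [J, SimpleGraph.edgeSet_fromEdgeSet] at he
    exact he.1
  have hclosed : ∀ a (p : J.Walk a a), (p.edges.map g).sum = 0 := by
    intro a p
    have hz : ∀ e, (p.edges.count e : ZMod 2) ≠ 0 → e ∈ K.edgeSet ∧ x e = 0 := by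
      intro e he
      refine hJe e (p.edges_subset_edgeSet (List.count_pos_iff.1 (Nat.pos_of_ne_zero ?_)))
      rintro h
      simp [h] at he
    have hle := hmax (fun e => x e + p.edges.count e) ⟨?_, ?_⟩
    · have hsub : ({e | x e ≠ 0} : Finset (Sym2 V)) ⊆
          ({e | x e + p.edges.count e ≠ 0} : Finset (Sym2 V)) := by
        intro e
        simp only [Finset.mem_filter, Finset.mem_univ, true_and]
        intro he
        have : (p.edges.count e : ZMod 2) = 0 := by
          by_contra h
          exact he (hz e h).2
        simpa [this] using he
      have heq := Finset.eq_of_subset_of_card_le hsub hle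
      rw [p.sum_map_edges]
      refine Finset.sum_eq_zero fun e _ => ?_
      have he := congrArg (e ∈ ·) heq
      simp only [Finset.mem_filter, Finset.mem_univ, true_and, eq_iff_iff] at he
      by_cases h : (p.edges.count e : ZMod 2) = 0
      · simp [h]
      · have h2 := (hz e h).2
        exact absurd h2 (he.2 (by simpa [h2] using h))
    · intro e he
      by_cases h : (p.edges.count e : ZMod 2) = 0
      · exact hx.1 e (by simpa [h] using he)
      · exact (hz e h).1
    · intro u
      rw [Finset.sum_add_distrib, hx.2, p.sum_count_edges_filter_mem, CharTwo.add_self_eq_zero,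
        add_zero]
  have hroot : ∀ a, J.Reachable (J.connectedComponentMk a).out a := fun a =>
    SimpleGraph.ConnectedComponent.exact (Quot.out_eq (J.connectedComponentMk a))
  refine ⟨fun a => (((hroot a).some).edges.map g).sum, fun a b hab hxab => ?_⟩
  have hJ : J.Adj a b := by
    simp only [J, SimpleGraph.fromEdgeSet_adj]
    exact ⟨⟨hab, hxab⟩, hab.ne⟩
  have hc : J.connectedComponentMk a = J.connectedComponentMk b :=
    SimpleGraph.ConnectedComponent.sound hJ.reachable
  have key := hclosed _ ((((hroot a).some).concat hJ).append
    (((hroot b).some).reverse.copy rfl (by rw [hc])))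
  simp only [SimpleGraph.Walk.edges_append, SimpleGraph.Walk.edges_concat,
    SimpleGraph.Walk.edges_copy, SimpleGraph.Walk.edges_reverse, List.map_append,
    List.concat_eq_append, List.map_reverse, List.sum_append, List.sum_reverse, List.map_cons,
    List.map_nil, List.sum_cons, List.sum_nil] at key
  linear_combination key - CharTwo.add_self_eq_zero (g s(a, b))

open Finset in
/-- Every finite set has a labelling whose two classes, and hence also those of the flipped
labelling, are empty or odd. -/
theorem Finset.exists_labelling_odd {α : Type*} [DecidableEq α] (R : Finset α) :
    ∃ f : α → ZMod 2, ∀ s i : ZMod 2,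
      #{e ∈ R | s + f e = i} = 0 ∨ Odd #{e ∈ R | s + f e = i} := by
  have hflip : ∀ s i : ZMod 2, s ≠ i → s + 1 = i := by decide
  rcases Nat.even_or_odd #R with hR | hR
  · rcases R.eq_empty_or_nonempty with rfl | ⟨a, ha⟩
    · exact ⟨0, by simp⟩
    · refine ⟨fun e => if e = a then 1 else 0, fun s i => Or.inr ?_⟩
      by_cases hsi : s = i
      · subst hsi
        have : {e ∈ R | s + (if e = a then 1 else 0) = s} = R.erase a := by
          ext e
          by_cases h : e = a <;> simp [h]
        rw [this, Finset.card_erase_of_mem ha]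
        have := Finset.card_pos.2 ⟨a, ha⟩
        grind
      · have : {e ∈ R | s + (if e = a then 1 else 0) = i} = {a} := by
          ext e
          by_cases h : e = a <;> simp [h, ha, hsi, hflip s i hsi]
        simp [this]
  · refine ⟨0, fun s i => ?_⟩
    by_cases hsi : s = i
    · simp [hsi, hR]
    · simp [hsi]

open Finset in
/-- The sum of a `ZMod 2`-valued function counts the points where it equals one. -/
theorem ZMod.natCast_card_filter_eq_one {α : Type*} (R : Finset α) (f : α → ZMod 2) :
    (#{e ∈ R | f e = 1} : ZMod 2) = ∑ e ∈ R, f e := by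
  have h : ∀ z : ZMod 2, (if z = 1 then 1 else 0) = z := by decide
  simp only [Finset.natCast_card_filter, h]

open Finset in
/-- Let `G` be a connected simple graph of odd order, `v` a vertex of even degree, and
`w` a neighbor of `v` of even degree such that `w` is not a cut vertex of `G − v`.
Then `G` admits an odd 3-edge-coloring. -/
theorem stmt_16 {V : Type*} [Fintype V] [DecidableEq V] (G : SimpleGraph V)
    [DecidableRel G.Adj]
    (hG : G.Connected) (hodd : Odd (Fintype.card V)) (v w : V)
    (hadj : G.Adj v w)
    (hdegv : Even (G.degree v)) (hdegw : Even (G.degree w))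
    (hnotcut : (G.induce (({v, w}ᶜ : Set V))).Connected) :
    ∃ φ : Sym2 V → Fin 3, ∀ (u : V) (j : Fin 3),
      {e | e ∈ G.edgeSet ∧ φ e = j ∧ u ∈ e}.ncard = 0 ∨
        Odd {e | e ∈ G.edgeSet ∧ φ e = j ∧ u ∈ e}.ncard := by
  classical
  have hvw : v ≠ w := hadj.ne
  let K : SimpleGraph V := (G.induce (({v, w}ᶜ : Set V))).spanningCoe
  let t : V → ZMod 2 := fun u =>
    if u = v ∨ u = w then 0 else 1 + if G.Adj w u then 1 else 0
  have hKadj : ∀ a b, K.Adj a b ↔ G.Adj a b ∧ (a ≠ v ∧ a ≠ w) ∧ (b ≠ v ∧ b ≠ w) := by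
    intro a b
    simp [K]
    tauto
  have htne : ∀ a, t a ≠ 0 → a ∈ ({v, w}ᶜ : Set V) := by
    intro a ha h
    exact ha (if_pos (by simpa using h))
  have hK : ∀ a b, t a ≠ 0 → t b ≠ 0 → K.Reachable a b := by
    intro a b ha hb
    exact (hnotcut.preconnected ⟨a, htne a ha⟩ ⟨b, htne b hb⟩).map
      (SimpleGraph.Embedding.spanningCoe _).toHom
  have ht : ∑ u, t u = 0 := by
    have htu : ∀ u, t u = 1 + (if G.Adj w u then 1 else 0) + if u = w then 1 else 0 := by
      intro u
      by_cases h1 : u = v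
      · subst h1
        simp [t, hvw, hadj.symm, CharTwo.add_self_eq_zero]
      · by_cases h2 : u = w
        · subst h2
          simp [t, CharTwo.add_self_eq_zero]
        · simp [t, h1, h2]
    have hn := ZMod.natCast_eq_one_iff_odd.2 hodd
    have hw := ZMod.natCast_eq_zero_iff_even.2 hdegw
    rw [← G.card_neighborFinset_eq_degree, G.neighborFinset_eq_filter,
      Finset.natCast_card_filter] at hw
    simp [htu, Finset.sum_add_distrib, hw, hn, CharTwo.add_self_eq_zero]
  obtain ⟨x, hxK, hxt, hcob⟩ := K.exists_join_coboundary t hK ht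
  let y : Sym2 V → ZMod 2 := fun e => if e ∈ G.edgeSet ∧ w ∈ e ∧ v ∉ e then 1 else x e
  have hy2 : ∀ e, y e ≠ 0 → y e = 1 := fun e => (by decide : ∀ z : ZMod 2, z ≠ 0 → z = 1) _
  let R : V → Finset (Sym2 V) := fun u => {e | e ∈ G.edgeSet ∧ y e = 0 ∧ u ∈ e}
  choose f hf using fun u => (R u).exists_labelling_odd
  obtain ⟨s, hs⟩ := hcob (Sym2.lift ⟨fun a b => f a s(a, b) + f b s(a, b), fun a b => by
    simp only [Sym2.eq_swap (a := b), add_comm (f b _)]⟩)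
  have hc : ∃ c : Sym2 V → ZMod 2, ∀ a, a ≠ v → a ≠ w → ∀ e ∈ R a, c e = s a + f a e := by
    refine ⟨fun e => if h : ∃ a ∈ e, a ≠ v ∧ a ≠ w then s h.choose + f h.choose e else 0, ?_⟩
    intro a hav haw e he
    simp only [R, Finset.mem_filter, Finset.mem_univ, true_and] at he
    obtain ⟨heG, hye, hae⟩ := he
    have h : ∃ a ∈ e, a ≠ v ∧ a ≠ w := ⟨a, hae, hav, haw⟩
    beta_reduce
    rw [dif_pos h]
    obtain ⟨hbe, hbv, hbw⟩ := h.choose_spec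
    generalize h.choose = b at hbe hbv hbw
    by_cases hab : a = b
    · rw [hab]
    · obtain rfl := (Sym2.mem_and_mem_iff hab).1 ⟨hae, hbe⟩
      have hx0 : x s(a, b) = 0 := by
        simpa [y, Ne.symm haw, Ne.symm hbw] using hye
      have := hs a b ((hKadj a b).2 ⟨heG, ⟨hav, haw⟩, hbv, hbw⟩) hx0
      simp only [Sym2.lift_mk] at this
      linear_combination this + CharTwo.add_self_eq_zero (f b s(a, b)) -
        CharTwo.add_self_eq_zero (s a)
  obtain ⟨c, hc⟩ := hc
  have hyv : ∀ e, v ∈ e → y e = 0 := by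
    intro e he
    simp only [y, he, not_true_eq_false, and_false, if_false]
    by_contra h
    have hKe := hxK e h
    induction e with
    | _ a b =>
      have := (hKadj a b).1 hKe
      rcases Sym2.mem_iff.1 he with rfl | rfl <;> simp at this
  have hyw : ∀ e ∈ G.edgeSet, w ∈ e → (y e = 0 ↔ e = s(v, w)) := by
    intro e heG he
    constructor
    · intro h
      by_cases hv : v ∈ e
      · exact (Sym2.mem_and_mem_iff hvw).1 ⟨hv, he⟩
      · simp [y, heG, he, hv] at h
    · rintro rfl
      exact hyv _ (Sym2.mem_mk_left _ _)
  have hd : ∃ d : Sym2 V → ZMod 2,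
      (∀ a, a ≠ v → a ≠ w → ∀ e ∈ R a, d e = s a + f a e) ∧
      Odd #{e ∈ R v | d e = 1} := by
    refine ⟨Function.update c s(v, w) (1 + ∑ e ∈ (R v).erase s(v, w), c e), ?_, ?_⟩
    · intro a hav haw e he
      rw [Function.update_of_ne, hc a hav haw e he]
      rintro rfl
      simp [R, hav, haw] at he
    · have hmem : s(v, w) ∈ R v := by simp [R, hadj, hyv]
      rw [← ZMod.natCast_eq_one_iff_odd, ZMod.natCast_card_filter_eq_one,
        ← Finset.add_sum_erase _ _ hmem, Function.update_self,
        Finset.sum_congr rfl fun e he => Function.update_of_ne (Finset.ne_of_mem_erase he) _ c,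
        add_assoc, CharTwo.add_self_eq_zero, add_zero]
  obtain ⟨d, hd, hdv⟩ := hd
  refine ⟨fun e => if y e = 0 then (if d e = 0 then 1 else 2) else 0, fun u j => ?_⟩
  have hφ : {e | e ∈ G.edgeSet ∧ (if y e = 0 then (if d e = 0 then 1 else 2) else 0) = j ∧ u ∈ e} =
      ((if j = 0 then ({e | e ∈ G.edgeSet ∧ y e = 1 ∧ u ∈ e} : Finset (Sym2 V))
        else if j = 1 then {e ∈ R u | d e = 0} else {e ∈ R u | d e = 1} :
        Finset (Sym2 V)) : Set (Sym2 V)) := by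
    have h01 : ∀ z : ZMod 2, z = 0 ∨ z = 1 := by decide
    ext e
    fin_cases j <;> rcases h01 (y e) with h | h <;> rcases h01 (d e) with hd' | hd' <;>
      simp [R, h, hd']
  rw [hφ, Set.ncard_coe_finset]
  by_cases huv : u = v
  · subst huv
    have hsplit : #{e ∈ R u | d e = 0} + #{e ∈ R u | d e = 1} = G.degree u := by
      have hRu : R u = G.incidenceFinset u := by
        ext e
        simp only [R, Finset.mem_filter, Finset.mem_univ, true_and,
          SimpleGraph.mem_incidenceFinset, SimpleGraph.incidenceSet, Set.mem_ofPred_eq]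
        exact ⟨fun h => ⟨h.1, h.2.2⟩, fun h => ⟨h.1, hyv e h.2, h.2⟩⟩
      have h01 : ∀ z : ZMod 2, z = 1 ↔ ¬ z = 0 := by decide
      simp only [h01]
      rw [Finset.card_filter_add_card_filter_not, hRu, G.card_incidenceFinset_eq_degree]
    fin_cases j
    · left
      simp only [Fin.zero_eta, if_true, Finset.card_eq_zero, Finset.filter_eq_empty_iff]
      rintro e - ⟨-, h1, h2⟩
      simp [hyv e h2] at h1
    · right
      simp only [Fin.mk_one, one_ne_zero, if_true, if_false]
      grind
    · exact Or.inr hdv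
  by_cases huw : u = w
  · subst huw
    have hRu : R u = {s(v, u)} := by
      ext e
      simp only [R, Finset.mem_filter, Finset.mem_univ, true_and, Finset.mem_singleton]
      constructor
      · rintro ⟨h1, h2, h3⟩
        exact (hyw e h1 h3).1 h2
      · rintro rfl
        exact ⟨hadj, hyv _ (Sym2.mem_mk_left _ _), Sym2.mem_mk_right _ _⟩
    have hclass : ∀ i, #{e ∈ R u | d e = i} = 0 ∨ Odd #{e ∈ R u | d e = i} := by
      intro i
      rw [hRu, Finset.filter_singleton]
      split_ifs <;> simp
    fin_cases j
    · right
      have : ({e | e ∈ G.edgeSet ∧ y e = 1 ∧ u ∈ e} : Finset (Sym2 V)) =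
          (G.incidenceFinset u).erase s(v, u) := by
        ext e
        simp only [Finset.mem_filter, Finset.mem_univ, true_and, Finset.mem_erase,
          SimpleGraph.mem_incidenceFinset, SimpleGraph.incidenceSet, Set.mem_ofPred_eq]
        constructor
        · rintro ⟨h1, h2, h3⟩
          refine ⟨fun h => ?_, h1, h3⟩
          simp [(hyw e h1 h3).2 h] at h2
        · rintro ⟨h1, h2, h3⟩
          exact ⟨h2, hy2 e fun h => h1 ((hyw e h2 h3).1 h), h3⟩
      simp only [Fin.zero_eta, if_true]
      have hpos : 0 < G.degree u := (G.degree_pos_iff_exists_adj u).2 ⟨v, hadj.symm⟩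
      rw [this, Finset.card_erase_of_mem
        (by simp [SimpleGraph.incidenceSet, hadj]), G.card_incidenceFinset_eq_degree]
      grind
    · exact hclass 0
    · exact hclass 1
  have hclass : ∀ i, #{e ∈ R u | d e = i} = 0 ∨ Odd #{e ∈ R u | d e = i} := by
    intro i
    rw [Finset.filter_congr (q := fun e => s u + f u e = i)
      fun e he => by rw [hd u huv huw e he]]
    exact hf u (s u) i
  fin_cases j
  · right
    have hyE : ∀ e, y e = 1 → e ∈ G.edgeSet := by
      intro e he
      by_cases h : e ∈ G.edgeSet ∧ w ∈ e ∧ v ∉ e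
      · exact h.1
      · have hKe := hxK e (by simp only [y, if_neg h] at he; simp [he])
        induction e with
        | _ a b => exact ((hKadj a b).1 hKe).1
    have hyx : ∀ e, u ∈ e →
        y e = x e + if s(w, u) = e then (if G.Adj w u then 1 else 0) else 0 := by
      intro e he
      by_cases hw : w ∈ e
      · obtain rfl := (Sym2.mem_and_mem_iff (Ne.symm huw)).1 ⟨hw, he⟩
        have hx0 : x s(w, u) = 0 := by
          by_contra h
          simpa using (hKadj w u).1 (hxK _ h)
        simp [y, hx0, hvw, Ne.symm huv]
      · rw [if_neg (by rintro rfl; simp at hw)]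
        simp [y, hw]
    have hfil : ({e | e ∈ G.edgeSet ∧ y e = 1 ∧ u ∈ e} : Finset (Sym2 V)) =
        {e ∈ ({e | u ∈ e} : Finset (Sym2 V)) | y e = 1} := by
      ext e
      simp only [Finset.mem_filter, Finset.mem_univ, true_and]
      exact ⟨fun h => ⟨h.2.2, h.2.1⟩, fun h => ⟨hyE e h.2, h.2, h.1⟩⟩
    simp only [Fin.zero_eta, if_true]
    rw [hfil, ← ZMod.natCast_eq_one_iff_odd, ZMod.natCast_card_filter_eq_one,
      Finset.sum_congr rfl fun e he => hyx e (Finset.mem_filter.1 he).2,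
      Finset.sum_add_distrib, hxt, Finset.sum_ite_eq]
    simp [t, huv, huw, add_assoc, CharTwo.add_self_eq_zero]
  · exact hclass 0
  · exact hclass 1
end
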